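/- Let C₀, M > 0. There exists a constant C₂ > 0, depending only on L, T, C₀, M (and not on ε), such that for every ε ∈ (0,1) and every classical solution u of the regularized problem (2.9) whose smooth data satisfy C₀⁻¹(1−y) ≤ u₀^ε, u₁^ε ≤ C₀(1−y), v₀^ε ≤ 0, with the C²-norms of u₀^ε, u₁^ε, v₀^ε, U, P bounded by M and U ≥ M⁻¹, and which satisfies C₁⁻¹(1−y) ≤ u ≤ C₁(1−y) on Q_T for some C₁ ≤ M, the full gradient is uniformly integrable: ∫_{Q_T} ( |∂_x u| + |∂_y u| + |∂_t u| ) dx dy dt ≤ C₂. -/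

import Mathlib

open Real Set MeasureTheory

noncomputable section

/-- Partial derivative in the first variable of a two-variable function. -/
def pd1 (f : ℝ → ℝ → ℝ) (x t : ℝ) : ℝ := deriv (fun x' => f x' t) x

/-- Partial derivative in the second variable of a two-variable function. -/
def pd2 (f : ℝ → ℝ → ℝ) (x t : ℝ) : ℝ := deriv (fun t' => f x t') t

/-- Partial derivatives of a function of `(x, y, t)`. -/
def Dx (u : ℝ → ℝ → ℝ → ℝ) (x y t : ℝ) : ℝ := deriv (fun s => u s y t) x
def Dy (u : ℝ → ℝ → ℝ → ℝ) (x y t : ℝ) : ℝ := deriv (fun s => u x s t) y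
def Dt (u : ℝ → ℝ → ℝ → ℝ) (x y t : ℝ) : ℝ := deriv (fun s => u x y s) t
def Dyy (u : ℝ → ℝ → ℝ → ℝ) (x y t : ℝ) : ℝ := iteratedDeriv 2 (fun s => u x s t) y

/-- The coefficient `b = (1-y²)∂ₓU + (1-y)∂ₜU/U`. -/
def bcoef (U : ℝ → ℝ → ℝ) (x y t : ℝ) : ℝ :=
  (1 - y ^ 2) * pd1 U x t + (1 - y) * pd2 U x t / U x t

/-- The coefficient `c = (1-y)∂ₓU - ∂ₓP/U`. -/
def ccoef (U P : ℝ → ℝ → ℝ) (x y t : ℝ) : ℝ :=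
  (1 - y) * pd1 U x t - pd1 P x t / U x t

def Smooth2 (f : ℝ → ℝ → ℝ) : Prop := ContDiff ℝ (⊤ : ℕ∞) (fun p : ℝ × ℝ => f p.1 p.2)
def Smooth3 (u : ℝ → ℝ → ℝ → ℝ) : Prop :=
  ContDiff ℝ (⊤ : ℕ∞) (fun p : ℝ × ℝ × ℝ => u p.1 p.2.1 p.2.2)

/-- `C²`-norm of `f` bounded by `M` on `s₁ × s₂`. -/
def C2Bound (f : ℝ → ℝ → ℝ) (s₁ s₂ : Set ℝ) (M : ℝ) : Prop :=
  ∀ x ∈ s₁, ∀ t ∈ s₂,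
    |f x t| ≤ M ∧ |pd1 f x t| ≤ M ∧ |pd2 f x t| ≤ M ∧
    |pd1 (pd1 f) x t| ≤ M ∧ |pd2 (pd2 f) x t| ≤ M ∧ |pd2 (pd1 f) x t| ≤ M

/-- Background Euler flow data: smooth `U > 0`, `P`, Bernoulli law, favorable pressure,
`C²`-norms bounded by `M` and `U ≥ M⁻¹`. -/
def EulerData (L T M : ℝ) (U P : ℝ → ℝ → ℝ) : Prop :=
  Smooth2 U ∧ Smooth2 P ∧
  (∀ x ∈ Icc 0 L, ∀ t ∈ Icc 0 T, 0 < U x t) ∧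
  (∀ x ∈ Icc 0 L, ∀ t ∈ Icc 0 T, pd2 U x t + U x t * pd1 U x t + pd1 P x t = 0) ∧
  (∀ x ∈ Icc 0 L, ∀ t ∈ Icc 0 T, pd1 P x t ≤ 0) ∧
  C2Bound U (Icc 0 L) (Icc 0 T) M ∧ C2Bound P (Icc 0 L) (Icc 0 T) M ∧
  (∀ x ∈ Icc 0 L, ∀ t ∈ Icc 0 T, M⁻¹ ≤ U x t)

/-- Classical solution of the regularized problem (2.9). -/
def RegSolution (L T ε : ℝ) (U P : ℝ → ℝ → ℝ)
    (u₀ u₁ v₀ : ℝ → ℝ → ℝ) (u : ℝ → ℝ → ℝ → ℝ) : Prop :=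
  Smooth3 u ∧
  (∀ x ∈ Ioo 0 L, ∀ y ∈ Ioo (0:ℝ) 1, ∀ t ∈ Ioo 0 T,
    Dt u x y t - (u x y t + ε) ^ 2 * Dyy u x y t + (y * U x t + ε) * Dx u x y t
      + bcoef U x y t * Dy u x y t + ccoef U P x y t * u x y t = 0) ∧
  (∀ x ∈ Icc 0 L, ∀ y ∈ Icc (0:ℝ) 1, u x y 0 = u₀ x y) ∧
  (∀ y ∈ Icc (0:ℝ) 1, ∀ t ∈ Icc 0 T, u 0 y t = u₁ y t) ∧
  (∀ x ∈ Icc 0 L, ∀ t ∈ Icc 0 T, u x 1 t = 0) ∧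
  (∀ x ∈ Icc 0 L, ∀ t ∈ Icc 0 T,
    (u x 0 t + ε) * Dy u x 0 t = v₀ x t * (u x 0 t + ε) + pd1 P x t / U x t)

/-- The data bounds: smooth nonnegative data with `C₀⁻¹(1-y) ≤ u₀, u₁ ≤ C₀(1-y)`, `v₀ ≤ 0`. -/
def DataBounds (L T C₀ : ℝ) (u₀ u₁ v₀ : ℝ → ℝ → ℝ) : Prop :=
  Smooth2 u₀ ∧ Smooth2 u₁ ∧ Smooth2 v₀ ∧
  (∀ x ∈ Icc 0 L, ∀ y ∈ Icc (0:ℝ) 1,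
    C₀⁻¹ * (1 - y) ≤ u₀ x y ∧ u₀ x y ≤ C₀ * (1 - y)) ∧
  (∀ y ∈ Icc (0:ℝ) 1, ∀ t ∈ Icc 0 T,
    C₀⁻¹ * (1 - y) ≤ u₁ y t ∧ u₁ y t ≤ C₀ * (1 - y)) ∧
  (∀ x ∈ Icc 0 L, ∀ t ∈ Icc 0 T, v₀ x t ≤ 0)

/-- The parabolic cylinder `Q_T = (0,L) × (0,1) × (0,T)`. -/
def QT (L T : ℝ) : Set (ℝ × ℝ × ℝ) := (Ioo 0 L) ×ˢ ((Ioo (0:ℝ) 1) ×ˢ (Ioo 0 T))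

section Calculus

variable {E : Type*} [NormedAddCommGroup E] [NormedSpace ℝ E]

theorem contDiff_fderiv_apply {f : E → ℝ} (hf : ContDiff ℝ (⊤ : ℕ∞) f) (v : E) :
    ContDiff ℝ (⊤ : ℕ∞) (fun p => fderiv ℝ f p v) :=
  (hf.fderiv_right (m := (⊤ : ℕ∞)) (by simp)).clm_apply contDiff_const

theorem fderiv_apply_comm {f : E → ℝ} (hf : ContDiff ℝ (⊤ : ℕ∞) f) (v w p : E) :
    fderiv ℝ (fun p => fderiv ℝ f p w) p v = fderiv ℝ (fun p => fderiv ℝ f p v) p w := by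
  have hd : DifferentiableAt ℝ (fderiv ℝ f) p :=
    ((hf.fderiv_right (m := (⊤ : ℕ∞)) (by simp)).differentiable (by simp)) p
  have key : ∀ a b : E, fderiv ℝ (fun p => fderiv ℝ f p a) p b
      = fderiv ℝ (fderiv ℝ f) p b a := by
    intro a b
    rw [fderiv_clm_apply hd (differentiableAt_const a)]
    simp
  rw [key, key]
  have hs : IsSymmSndFDerivAt ℝ f p :=
    (hf.contDiffAt (x := p)).isSymmSndFDerivAt (by
      simp only [minSmoothness_of_isRCLikeNormedField]; exact WithTop.coe_le_coe.2 le_top)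
  exact hs v w

end Calculus

section Smooth3

variable {u : ℝ → ℝ → ℝ → ℝ}

theorem Smooth3.hasDerivAt_x_fderiv (hu : Smooth3 u) (x y t : ℝ) :
    HasDerivAt (fun s => u s y t)
      (fderiv ℝ (fun p : ℝ × ℝ × ℝ => u p.1 p.2.1 p.2.2) (x, y, t) (1, 0, 0)) x := by
  have h1 := (hu.differentiable (by simp) (x, y, t)).hasFDerivAt
  have h2 : HasDerivAt (fun s : ℝ => ((s, y, t) : ℝ × ℝ × ℝ)) (1, 0, 0) x :=
    (hasDerivAt_id x).prodMk (hasDerivAt_const x (y, t))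
  exact h1.comp_hasDerivAt x h2

theorem Smooth3.hasDerivAt_y_fderiv (hu : Smooth3 u) (x y t : ℝ) :
    HasDerivAt (fun s => u x s t)
      (fderiv ℝ (fun p : ℝ × ℝ × ℝ => u p.1 p.2.1 p.2.2) (x, y, t) (0, 1, 0)) y := by
  have h1 := (hu.differentiable (by simp) (x, y, t)).hasFDerivAt
  have h2 : HasDerivAt (fun s : ℝ => ((x, s, t) : ℝ × ℝ × ℝ)) (0, 1, 0) y :=
    (hasDerivAt_const y x).prodMk ((hasDerivAt_id y).prodMk (hasDerivAt_const y t))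
  exact h1.comp_hasDerivAt y h2

theorem Smooth3.hasDerivAt_t_fderiv (hu : Smooth3 u) (x y t : ℝ) :
    HasDerivAt (fun s => u x y s)
      (fderiv ℝ (fun p : ℝ × ℝ × ℝ => u p.1 p.2.1 p.2.2) (x, y, t) (0, 0, 1)) t := by
  have h1 := (hu.differentiable (by simp) (x, y, t)).hasFDerivAt
  have h2 : HasDerivAt (fun s : ℝ => ((x, y, s) : ℝ × ℝ × ℝ)) (0, 0, 1) t :=
    (hasDerivAt_const t x).prodMk ((hasDerivAt_const t y).prodMk (hasDerivAt_id t))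
  exact h1.comp_hasDerivAt t h2

theorem Smooth3.hasDerivAt_x (hu : Smooth3 u) (x y t : ℝ) :
    HasDerivAt (fun s => u s y t) (Dx u x y t) x :=
  (hu.hasDerivAt_x_fderiv x y t).differentiableAt.hasDerivAt

theorem Smooth3.hasDerivAt_y (hu : Smooth3 u) (x y t : ℝ) :
    HasDerivAt (fun s => u x s t) (Dy u x y t) y :=
  (hu.hasDerivAt_y_fderiv x y t).differentiableAt.hasDerivAt

theorem Smooth3.hasDerivAt_t (hu : Smooth3 u) (x y t : ℝ) :
    HasDerivAt (fun s => u x y s) (Dt u x y t) t :=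
  (hu.hasDerivAt_t_fderiv x y t).differentiableAt.hasDerivAt

theorem Smooth3.Dx_eq (hu : Smooth3 u) : (fun p : ℝ × ℝ × ℝ => Dx u p.1 p.2.1 p.2.2)
    = fun p => fderiv ℝ (fun p : ℝ × ℝ × ℝ => u p.1 p.2.1 p.2.2) p (1, 0, 0) :=
  funext fun p => (hu.hasDerivAt_x_fderiv p.1 p.2.1 p.2.2).deriv

theorem Smooth3.Dy_eq (hu : Smooth3 u) : (fun p : ℝ × ℝ × ℝ => Dy u p.1 p.2.1 p.2.2)
    = fun p => fderiv ℝ (fun p : ℝ × ℝ × ℝ => u p.1 p.2.1 p.2.2) p (0, 1, 0) :=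
  funext fun p => (hu.hasDerivAt_y_fderiv p.1 p.2.1 p.2.2).deriv

theorem Smooth3.Dt_eq (hu : Smooth3 u) : (fun p : ℝ × ℝ × ℝ => Dt u p.1 p.2.1 p.2.2)
    = fun p => fderiv ℝ (fun p : ℝ × ℝ × ℝ => u p.1 p.2.1 p.2.2) p (0, 0, 1) :=
  funext fun p => (hu.hasDerivAt_t_fderiv p.1 p.2.1 p.2.2).deriv

theorem Smooth3.Dx (hu : Smooth3 u) : Smooth3 (Dx u) := by
  unfold Smooth3; rw [hu.Dx_eq]; exact contDiff_fderiv_apply hu _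

theorem Smooth3.Dy (hu : Smooth3 u) : Smooth3 (Dy u) := by
  unfold Smooth3; rw [hu.Dy_eq]; exact contDiff_fderiv_apply hu _

theorem Smooth3.Dt (hu : Smooth3 u) : Smooth3 (Dt u) := by
  unfold Smooth3; rw [hu.Dt_eq]; exact contDiff_fderiv_apply hu _

theorem Smooth3.Dx_Dy (hu : Smooth3 u) (x y t : ℝ) :
    _root_.Dx (_root_.Dy u) x y t = _root_.Dy (_root_.Dx u) x y t := by
  have h1 := congrFun hu.Dy.Dx_eq (x, y, t)
  have h2 := congrFun hu.Dx.Dy_eq (x, y, t)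
  rw [hu.Dy_eq] at h1
  rw [hu.Dx_eq] at h2
  exact h1.trans ((fderiv_apply_comm hu _ _ _).trans h2.symm)

theorem Smooth3.Dt_Dy (hu : Smooth3 u) (x y t : ℝ) :
    _root_.Dt (_root_.Dy u) x y t = _root_.Dy (_root_.Dt u) x y t := by
  have h1 := congrFun hu.Dy.Dt_eq (x, y, t)
  have h2 := congrFun hu.Dt.Dy_eq (x, y, t)
  rw [hu.Dy_eq] at h1
  rw [hu.Dt_eq] at h2
  exact h1.trans ((fderiv_apply_comm hu _ _ _).trans h2.symm)

theorem Smooth3.Dx_Dt (hu : Smooth3 u) (x y t : ℝ) :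
    _root_.Dx (_root_.Dt u) x y t = _root_.Dt (_root_.Dx u) x y t := by
  have h1 := congrFun hu.Dt.Dx_eq (x, y, t)
  have h2 := congrFun hu.Dx.Dt_eq (x, y, t)
  rw [hu.Dt_eq] at h1
  rw [hu.Dx_eq] at h2
  exact h1.trans ((fderiv_apply_comm hu _ _ _).trans h2.symm)

theorem Dyy_eq_Dy_Dy (u : ℝ → ℝ → ℝ → ℝ) : Dyy u = Dy (Dy u) := by
  funext x y t
  simp only [Dyy, iteratedDeriv_succ, iteratedDeriv_zero]
  rfl

theorem Smooth3.add_const (hu : Smooth3 u) (r : ℝ) : Smooth3 (fun x y t => u x y t + r) :=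
  ContDiff.add hu contDiff_const

end Smooth3

section Smooth2

variable {f : ℝ → ℝ → ℝ}

theorem Smooth2.hasDerivAt_fst_fderiv (hf : Smooth2 f) (x t : ℝ) :
    HasDerivAt (fun s => f s t)
      (fderiv ℝ (fun p : ℝ × ℝ => f p.1 p.2) (x, t) (1, 0)) x := by
  have h1 := (hf.differentiable (by simp) (x, t)).hasFDerivAt
  have h2 : HasDerivAt (fun s : ℝ => ((s, t) : ℝ × ℝ)) (1, 0) x :=
    (hasDerivAt_id x).prodMk (hasDerivAt_const x t)
  exact h1.comp_hasDerivAt x h2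

theorem Smooth2.hasDerivAt_snd_fderiv (hf : Smooth2 f) (x t : ℝ) :
    HasDerivAt (fun s => f x s)
      (fderiv ℝ (fun p : ℝ × ℝ => f p.1 p.2) (x, t) (0, 1)) t := by
  have h1 := (hf.differentiable (by simp) (x, t)).hasFDerivAt
  have h2 : HasDerivAt (fun s : ℝ => ((x, s) : ℝ × ℝ)) (0, 1) t :=
    (hasDerivAt_const t x).prodMk (hasDerivAt_id t)
  exact h1.comp_hasDerivAt t h2

theorem Smooth2.hasDerivAt_fst (hf : Smooth2 f) (x t : ℝ) :
    HasDerivAt (fun s => f s t) (pd1 f x t) x :=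
  (hf.hasDerivAt_fst_fderiv x t).differentiableAt.hasDerivAt

theorem Smooth2.hasDerivAt_snd (hf : Smooth2 f) (x t : ℝ) :
    HasDerivAt (fun s => f x s) (pd2 f x t) t :=
  (hf.hasDerivAt_snd_fderiv x t).differentiableAt.hasDerivAt

theorem Smooth2.pd1_eq (hf : Smooth2 f) : (fun p : ℝ × ℝ => pd1 f p.1 p.2)
    = fun p => fderiv ℝ (fun p : ℝ × ℝ => f p.1 p.2) p (1, 0) :=
  funext fun p => (hf.hasDerivAt_fst_fderiv p.1 p.2).deriv

theorem Smooth2.pd2_eq (hf : Smooth2 f) : (fun p : ℝ × ℝ => pd2 f p.1 p.2)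
    = fun p => fderiv ℝ (fun p : ℝ × ℝ => f p.1 p.2) p (0, 1) :=
  funext fun p => (hf.hasDerivAt_snd_fderiv p.1 p.2).deriv

theorem Smooth2.pd1 (hf : Smooth2 f) : Smooth2 (pd1 f) := by
  unfold Smooth2; rw [hf.pd1_eq]; exact contDiff_fderiv_apply hf _

theorem Smooth2.pd2 (hf : Smooth2 f) : Smooth2 (pd2 f) := by
  unfold Smooth2; rw [hf.pd2_eq]; exact contDiff_fderiv_apply hf _

theorem Smooth2.pd1_pd2 (hf : Smooth2 f) (x t : ℝ) :
    _root_.pd1 (_root_.pd2 f) x t = _root_.pd2 (_root_.pd1 f) x t := by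
  have h1 := congrFun hf.pd2.pd1_eq (x, t)
  have h2 := congrFun hf.pd1.pd2_eq (x, t)
  rw [hf.pd2_eq] at h1
  rw [hf.pd1_eq] at h2
  exact h1.trans ((fderiv_apply_comm hf _ _ _).trans h2.symm)

theorem Smooth2.continuous_xt (hf : Smooth2 f) :
    Continuous (fun p : ℝ × ℝ × ℝ => f p.1 p.2.2) :=
  (ContDiff.continuous hf).comp (by fun_prop : Continuous fun p : ℝ × ℝ × ℝ => (p.1, p.2.2))

end Smooth2

/-- The closed cylinder `[0,L] × [0,1] × [0,T]`. -/
def closedCylinder (L T : ℝ) : Set (ℝ × ℝ × ℝ) := (Icc 0 L) ×ˢ ((Icc (0:ℝ) 1) ×ˢ (Icc 0 T))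

section Divergence

variable {L T : ℝ}

theorem isCompact_closedCylinder (L T : ℝ) : IsCompact (closedCylinder L T) :=
  isCompact_Icc.prod (isCompact_Icc.prod isCompact_Icc)

theorem QT_subset_closedCylinder (L T : ℝ) : QT L T ⊆ closedCylinder L T :=
  prod_mono Ioo_subset_Icc_self (prod_mono Ioo_subset_Icc_self Ioo_subset_Icc_self)

theorem measurableSet_QT (L T : ℝ) : MeasurableSet (QT L T) :=
  measurableSet_Ioo.prod (measurableSet_Ioo.prod measurableSet_Ioo)

theorem integrableOn_QT {f : ℝ × ℝ × ℝ → ℝ} (hf : ContinuousOn f (closedCylinder L T)) :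
    IntegrableOn f (QT L T) :=
  (hf.integrableOn_compact (isCompact_closedCylinder L T)).mono_set (QT_subset_closedCylinder L T)

theorem setIntegral_Ioo_eq_sub {a b : ℝ} (hab : a ≤ b) {f g : ℝ → ℝ}
    (hf : ∀ x ∈ Icc a b, HasDerivAt f (g x) x) (hg : ContinuousOn g (Icc a b)) :
    ∫ x in Ioo a b, g x = f b - f a := by
  rw [← integral_Ioc_eq_integral_Ioo, ← intervalIntegral.integral_of_le hab]
  rw [← uIcc_of_le hab] at hf hg
  exact intervalIntegral.integral_eq_sub_of_hasDerivAt hf hg.intervalIntegrable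

theorem neg_mul_le_integral_QT_x (hL : 0 < L) (hT : 0 < T) {F G : ℝ → ℝ → ℝ → ℝ} {B : ℝ}
    (hF : ∀ x ∈ Icc 0 L, ∀ y ∈ Icc (0:ℝ) 1, ∀ t ∈ Icc 0 T,
      HasDerivAt (fun s => F s y t) (G x y t) x)
    (hG : ContinuousOn (fun p : ℝ × ℝ × ℝ => G p.1 p.2.1 p.2.2) (closedCylinder L T))
    (hB : ∀ y ∈ Ioo (0:ℝ) 1, ∀ t ∈ Ioo 0 T, F 0 y t - F L y t ≤ B) :
    -(B * T) ≤ ∫ p in QT L T, G p.1 p.2.1 p.2.2 := by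
  have hi := integrableOn_QT hG
  rw [QT, Measure.volume_eq_prod, ← setIntegral_prod_swap, setIntegral_prod _ ?_]
  swap
  · unfold IntegrableOn QT at hi
    rw [Measure.volume_eq_prod, ← Measure.prod_restrict] at hi
    have := hi.swap
    rwa [Measure.prod_restrict] at this
  have hin : ∀ q ∈ (Ioo (0:ℝ) 1) ×ˢ (Ioo 0 T), (-B : ℝ) ≤ ∫ x in Ioo 0 L, G x q.1 q.2 := by
    intro q hq
    have hy := Ioo_subset_Icc_self hq.1
    have ht := Ioo_subset_Icc_self hq.2
    rw [setIntegral_Ioo_eq_sub hL.le (f := fun s => F s q.1 q.2) (fun x hx => hF x hx _ hy _ ht)]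
    · linarith [hB _ hq.1 _ hq.2]
    · exact hG.comp (f := fun x : ℝ => (x, q.1, q.2)) (by fun_prop) fun x hx => ⟨hx, hy, ht⟩
  have hvol : volume ((Ioo (0:ℝ) 1) ×ˢ (Ioo 0 T)) = ENNReal.ofReal T := by
    rw [Measure.volume_eq_prod, Measure.prod_prod]; simp
  have hm : MeasurableSet ((Ioo (0:ℝ) 1) ×ˢ (Ioo 0 T)) := measurableSet_Ioo.prod measurableSet_Ioo
  have h1 : ∫ q in (Ioo (0:ℝ) 1) ×ˢ (Ioo 0 T), (-B : ℝ) = -(B * T) := by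
    rw [setIntegral_const, Measure.real, hvol, ENNReal.toReal_ofReal hT.le]; simp; ring
  rw [← h1]
  refine setIntegral_mono_on (integrableOn_const (by rw [hvol]; simp) (by simp)) ?_ hm hin
  have h3 : Integrable (fun z : (ℝ × ℝ) × ℝ => G z.2 z.1.1 z.1.2)
      ((volume.restrict ((Ioo (0:ℝ) 1) ×ˢ (Ioo 0 T))).prod (volume.restrict (Ioo 0 L))) := by
    unfold IntegrableOn QT at hi
    rw [Measure.volume_eq_prod, ← Measure.prod_restrict] at hi
    exact hi.swap
  exact h3.integral_prod_left

theorem neg_mul_le_integral_QT_y (hL : 0 < L) (hT : 0 < T) {F G : ℝ → ℝ → ℝ → ℝ} {B : ℝ}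
    (hF : ∀ x ∈ Icc 0 L, ∀ y ∈ Icc (0:ℝ) 1, ∀ t ∈ Icc 0 T,
      HasDerivAt (fun s => F x s t) (G x y t) y)
    (hG : ContinuousOn (fun p : ℝ × ℝ × ℝ => G p.1 p.2.1 p.2.2) (closedCylinder L T))
    (hB : ∀ x ∈ Ioo 0 L, ∀ t ∈ Ioo 0 T, F x 0 t - F x 1 t ≤ B) :
    -(B * (L * T)) ≤ ∫ p in QT L T, G p.1 p.2.1 p.2.2 := by
  have hi := integrableOn_QT hG
  have hi' : Integrable (fun p : ℝ × ℝ × ℝ => G p.1 p.2.1 p.2.2)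
      ((volume.restrict (Ioo 0 L)).prod (volume.restrict ((Ioo (0:ℝ) 1) ×ˢ (Ioo 0 T)))) := by
    unfold IntegrableOn QT at hi
    rwa [Measure.volume_eq_prod, ← Measure.prod_restrict] at hi
  have hvol : volume (Ioo 0 L) = ENNReal.ofReal L := by simp
  have hvolT : volume (Ioo 0 T) = ENNReal.ofReal T := by simp
  have hin : ∀ x ∈ Ioo 0 L, -(B * T) ≤ ∫ q in (Ioo (0:ℝ) 1) ×ˢ (Ioo 0 T), G x q.1 q.2 := by
    intro x hx
    have hx' := Ioo_subset_Icc_self hx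
    have hc : ContinuousOn (fun q : ℝ × ℝ => G x q.1 q.2) ((Icc (0:ℝ) 1) ×ˢ (Icc 0 T)) :=
      hG.comp (f := fun q : ℝ × ℝ => (x, q.1, q.2)) (by fun_prop) fun q hq => ⟨hx', hq.1, hq.2⟩
    have hci : IntegrableOn (fun q : ℝ × ℝ => G x q.1 q.2) ((Ioo (0:ℝ) 1) ×ˢ (Ioo 0 T)) :=
      (hc.integrableOn_compact (isCompact_Icc.prod isCompact_Icc)).mono_set
        (prod_mono Ioo_subset_Icc_self Ioo_subset_Icc_self)
    have hci' : Integrable (fun q : ℝ × ℝ => G x q.2 q.1)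
        ((volume.restrict (Ioo 0 T)).prod (volume.restrict (Ioo (0:ℝ) 1))) := by
      unfold IntegrableOn at hci
      rw [Measure.volume_eq_prod, ← Measure.prod_restrict] at hci
      exact hci.swap
    rw [Measure.volume_eq_prod, ← setIntegral_prod_swap, setIntegral_prod _ ?_]
    swap
    · rw [Measure.prod_restrict] at hci'; exact hci'
    have h1 : ∫ t in Ioo 0 T, (-B : ℝ) = -(B * T) := by
      rw [setIntegral_const, Measure.real, hvolT, ENNReal.toReal_ofReal hT.le]; simp; ring
    rw [← h1]
    refine setIntegral_mono_on (integrableOn_const (by rw [hvolT]; simp) (by simp))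
      hci'.integral_prod_left measurableSet_Ioo ?_
    intro t ht
    have ht' := Ioo_subset_Icc_self ht
    change -B ≤ ∫ y in Ioo (0:ℝ) 1, G x y t
    rw [setIntegral_Ioo_eq_sub zero_le_one (f := fun s => F x s t)
      (fun y hy => hF x hx' y hy t ht')]
    · linarith [hB _ hx _ ht]
    · exact hc.comp (f := fun y : ℝ => (y, t)) (by fun_prop) fun y hy => ⟨hy, ht'⟩
  rw [QT, Measure.volume_eq_prod, setIntegral_prod _ hi]
  have h1 : ∫ x in Ioo 0 L, (-(B * T) : ℝ) = -(B * (L * T)) := by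
    rw [setIntegral_const, Measure.real, hvol, ENNReal.toReal_ofReal hL.le]; simp; ring
  rw [← h1]
  exact setIntegral_mono_on (integrableOn_const (by rw [hvol]; simp) enorm_ne_top)
    hi'.integral_prod_left measurableSet_Ioo hin

theorem neg_mul_le_integral_QT_t (hL : 0 < L) (hT : 0 < T) {F G : ℝ → ℝ → ℝ → ℝ} {B : ℝ}
    (hF : ∀ x ∈ Icc 0 L, ∀ y ∈ Icc (0:ℝ) 1, ∀ t ∈ Icc 0 T,
      HasDerivAt (fun s => F x y s) (G x y t) t)
    (hG : ContinuousOn (fun p : ℝ × ℝ × ℝ => G p.1 p.2.1 p.2.2) (closedCylinder L T))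
    (hB : ∀ x ∈ Ioo 0 L, ∀ y ∈ Ioo (0:ℝ) 1, F x y 0 - F x y T ≤ B) :
    -(B * L) ≤ ∫ p in QT L T, G p.1 p.2.1 p.2.2 := by
  have hi := integrableOn_QT hG
  have hi' : Integrable (fun p : ℝ × ℝ × ℝ => G p.1 p.2.1 p.2.2)
      ((volume.restrict (Ioo 0 L)).prod (volume.restrict ((Ioo (0:ℝ) 1) ×ˢ (Ioo 0 T)))) := by
    unfold IntegrableOn QT at hi
    rwa [Measure.volume_eq_prod, ← Measure.prod_restrict] at hi
  have hvol : volume (Ioo 0 L) = ENNReal.ofReal L := by simp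
  have hvol1 : volume (Ioo (0:ℝ) 1) = 1 := by simp
  have hin : ∀ x ∈ Ioo 0 L, -B ≤ ∫ q in (Ioo (0:ℝ) 1) ×ˢ (Ioo 0 T), G x q.1 q.2 := by
    intro x hx
    have hx' := Ioo_subset_Icc_self hx
    have hc : ContinuousOn (fun q : ℝ × ℝ => G x q.1 q.2) ((Icc (0:ℝ) 1) ×ˢ (Icc 0 T)) :=
      hG.comp (f := fun q : ℝ × ℝ => (x, q.1, q.2)) (by fun_prop) fun q hq => ⟨hx', hq.1, hq.2⟩
    have hci : IntegrableOn (fun q : ℝ × ℝ => G x q.1 q.2) ((Ioo (0:ℝ) 1) ×ˢ (Ioo 0 T)) :=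
      (hc.integrableOn_compact (isCompact_Icc.prod isCompact_Icc)).mono_set
        (prod_mono Ioo_subset_Icc_self Ioo_subset_Icc_self)
    have hci' : Integrable (fun q : ℝ × ℝ => G x q.1 q.2)
        ((volume.restrict (Ioo (0:ℝ) 1)).prod (volume.restrict (Ioo 0 T))) := by
      unfold IntegrableOn at hci
      rwa [Measure.volume_eq_prod, ← Measure.prod_restrict] at hci
    rw [Measure.volume_eq_prod, setIntegral_prod _ hci]
    have h1 : ∫ y in Ioo (0:ℝ) 1, (-B : ℝ) = -B := by
      rw [setIntegral_const, Measure.real, hvol1]; simp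
    rw [← h1]
    refine setIntegral_mono_on (integrableOn_const (by rw [hvol1]; simp) (by simp))
      hci'.integral_prod_left measurableSet_Ioo ?_
    intro y hy
    have hy' := Ioo_subset_Icc_self hy
    change -B ≤ ∫ t in Ioo 0 T, G x y t
    rw [setIntegral_Ioo_eq_sub hT.le (f := fun s => F x y s)
      (fun t ht => hF x hx' y hy' t ht)]
    · linarith [hB _ hx _ hy]
    · exact hc.comp (f := fun t : ℝ => (y, t)) (by fun_prop) fun t ht => ⟨hy', ht⟩
  rw [QT, Measure.volume_eq_prod, setIntegral_prod _ hi]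
  have h1 : ∫ x in Ioo 0 L, (-B : ℝ) = -(B * L) := by
    rw [setIntegral_const, Measure.real, hvol, ENNReal.toReal_ofReal hL.le]; simp; ring
  rw [← h1]
  exact setIntegral_mono_on (integrableOn_const (by rw [hvol]; simp) (by simp))
    hi'.integral_prod_left measurableSet_Ioo hin

theorem integral_QT_const (hL : 0 < L) (hT : 0 < T) (C : ℝ) :
    ∫ _p in QT L T, C = C * (L * T) := by
  have hvol : volume (QT L T) = ENNReal.ofReal (L * T) := by
    rw [QT, Measure.volume_eq_prod, Measure.prod_prod, Measure.volume_eq_prod, Measure.prod_prod]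
    simp [ENNReal.ofReal_mul hL.le]
  rw [setIntegral_const, Measure.real, hvol, ENNReal.toReal_ofReal (by positivity)]
  simp; ring

/-- A pointwise bound on `h + div F` yields a bound on the integral of `h` in terms of the
boundary fluxes of `F`. -/
theorem integral_QT_le_of_add_div_le (hL : 0 < L) (hT : 0 < T)
    {F₁ F₂ F₃ G₁ G₂ G₃ h : ℝ → ℝ → ℝ → ℝ} {C B₁ B₂ B₃ : ℝ}
    (hF₁ : ∀ x ∈ Icc 0 L, ∀ y ∈ Icc (0:ℝ) 1, ∀ t ∈ Icc 0 T,
      HasDerivAt (fun s => F₁ s y t) (G₁ x y t) x)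
    (hF₂ : ∀ x ∈ Icc 0 L, ∀ y ∈ Icc (0:ℝ) 1, ∀ t ∈ Icc 0 T,
      HasDerivAt (fun s => F₂ x s t) (G₂ x y t) y)
    (hF₃ : ∀ x ∈ Icc 0 L, ∀ y ∈ Icc (0:ℝ) 1, ∀ t ∈ Icc 0 T,
      HasDerivAt (fun s => F₃ x y s) (G₃ x y t) t)
    (hG₁ : ContinuousOn (fun p : ℝ × ℝ × ℝ => G₁ p.1 p.2.1 p.2.2) (closedCylinder L T))
    (hG₂ : ContinuousOn (fun p : ℝ × ℝ × ℝ => G₂ p.1 p.2.1 p.2.2) (closedCylinder L T))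
    (hG₃ : ContinuousOn (fun p : ℝ × ℝ × ℝ => G₃ p.1 p.2.1 p.2.2) (closedCylinder L T))
    (hh : ContinuousOn (fun p : ℝ × ℝ × ℝ => h p.1 p.2.1 p.2.2) (closedCylinder L T))
    (hle : ∀ x ∈ Ioo 0 L, ∀ y ∈ Ioo (0:ℝ) 1, ∀ t ∈ Ioo 0 T,
      h x y t + G₁ x y t + G₂ x y t + G₃ x y t ≤ C)
    (hB₁ : ∀ y ∈ Ioo (0:ℝ) 1, ∀ t ∈ Ioo 0 T, F₁ 0 y t - F₁ L y t ≤ B₁)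
    (hB₂ : ∀ x ∈ Ioo 0 L, ∀ t ∈ Ioo 0 T, F₂ x 0 t - F₂ x 1 t ≤ B₂)
    (hB₃ : ∀ x ∈ Ioo 0 L, ∀ y ∈ Ioo (0:ℝ) 1, F₃ x y 0 - F₃ x y T ≤ B₃) :
    ∫ p in QT L T, h p.1 p.2.1 p.2.2 ≤ C * (L * T) + B₁ * T + B₂ * (L * T) + B₃ * L := by
  have e₁ := neg_mul_le_integral_QT_x hL hT hF₁ hG₁ hB₁
  have e₂ := neg_mul_le_integral_QT_y hL hT hF₂ hG₂ hB₂
  have e₃ := neg_mul_le_integral_QT_t hL hT hF₃ hG₃ hB₃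
  have i₁ := integrableOn_QT hG₁
  have i₂ := integrableOn_QT hG₂
  have i₃ := integrableOn_QT hG₃
  have i := integrableOn_QT hh
  have i₁₂ : IntegrableOn (fun p : ℝ × ℝ × ℝ => h p.1 p.2.1 p.2.2 + G₁ p.1 p.2.1 p.2.2)
      (QT L T) := i.add i₁
  have i₁₂₃ : IntegrableOn (fun p : ℝ × ℝ × ℝ => h p.1 p.2.1 p.2.2 + G₁ p.1 p.2.1 p.2.2
      + G₂ p.1 p.2.1 p.2.2) (QT L T) := i₁₂.add i₂
  have hsum : ∫ p in QT L T, (h p.1 p.2.1 p.2.2 + G₁ p.1 p.2.1 p.2.2 + G₂ p.1 p.2.1 p.2.2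
      + G₃ p.1 p.2.1 p.2.2) ≤ ∫ _p in QT L T, C :=
    setIntegral_mono_on (i₁₂₃.add i₃) (integrableOn_QT continuousOn_const)
      (measurableSet_QT L T) fun p hp => hle _ hp.1 _ hp.2.1 _ hp.2.2
  rw [integral_QT_const hL hT, integral_add i₁₂₃ i₃, integral_add i₁₂ i₂,
    integral_add i i₁] at hsum
  linarith

end Divergence

section WeightedEstimate

/-- Expansion of the divergence of the flux used for the weighted `L¹` estimate, with `j` the
regularized absolute value of `z`. -/
theorem weighted_flux_identity {e φ w z zx zy zt zyy wx wy wt A Ax b b' r j δ K : ℝ}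
    (hw : w ≠ 0) (hj : j ≠ 0) (hjz : j ^ 2 = z ^ 2 + δ ^ 2) :
    (e * φ * (Ax * j / w ^ 2 + A * (z * zx / (j * w ^ 2) - 2 * j * wx / w ^ 3)))
      + (e * (b' * φ * j / w ^ 2 - b * j / w ^ 2
        + b * φ * (z * zy / (j * w ^ 2) - 2 * j * wy / w ^ 3)
        - φ * ((zy ^ 2 + z * zyy) / j - z ^ 2 * zy ^ 2 / j ^ 3)))
      + (e * φ * (-K * j / w ^ 2 + z * zt / (j * w ^ 2) - 2 * j * wt / w ^ 3))
    = e * φ * j / w ^ 2 * (Ax + b' - K) - e * b * j / w ^ 2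
      + e * φ * z / (j * w ^ 2) * (zt - w ^ 2 * zyy + A * zx + b * zy
        + (r - 2 * (wt + A * wx + b * wy) / w) * z)
      - e * φ * r * z ^ 2 / (j * w ^ 2)
      - 2 * e * φ * (wt + A * wx + b * wy) * δ ^ 2 / (j * w ^ 3)
      - e * φ * zy ^ 2 * δ ^ 2 / j ^ 3 := by
  have hδ : δ ^ 2 = j ^ 2 - z ^ 2 := by linarith
  rw [hδ]
  field_simp
  ring

theorem weighted_flux_le {e φ w z zx zy zt zyy wx wy wt A Ax b b' r j δ k S : ℝ}
    (he : 0 < e) (he1 : e ≤ 1) (hφ : 0 < φ) (hw : 0 < w) (hj : 0 < j)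
    (hjz : j ^ 2 = z ^ 2 + δ ^ 2) (hδ : 0 < δ) (hS : 0 ≤ S) (hk : 0 ≤ k)
    (hAx : |Ax| ≤ k) (hb' : |b'| ≤ k) (hb : |b| ≤ k * φ) (hr : |r| ≤ k)
    (hX : φ * |zt - w ^ 2 * zyy + A * zx + b * zy + (r - 2 * (wt + A * wx + b * wy) / w) * z|
      ≤ k * φ * |z| + w ^ 2 * S) :
    (e * (φ * |z| / w ^ 2) - S)
      + (e * φ * (Ax * j / w ^ 2 + A * (z * zx / (j * w ^ 2) - 2 * j * wx / w ^ 3)))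
      + (e * (b' * φ * j / w ^ 2 - b * j / w ^ 2
        + b * φ * (z * zy / (j * w ^ 2) - 2 * j * wy / w ^ 3)
        - φ * ((zy ^ 2 + z * zyy) / j - z ^ 2 * zy ^ 2 / j ^ 3)))
      + (e * φ * (-(5 * k + 1) * j / w ^ 2 + z * zt / (j * w ^ 2) - 2 * j * wt / w ^ 3))
    ≤ δ * (2 * φ * |wt + A * wx + b * wy| / w ^ 3) := by
  have hid := weighted_flux_identity (e := e) (φ := φ) (zx := zx) (zy := zy) (zt := zt)
    (zyy := zyy) (wx := wx) (wy := wy) (wt := wt) (A := A) (Ax := Ax) (b := b) (b' := b') (r := r)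
    (K := 5 * k + 1) hw.ne' hj.ne' hjz
  generalize wt + A * wx + b * wy = D at *
  generalize zt - w ^ 2 * zyy + A * zx + b * zy + (r - 2 * D / w) * z = X at *
  have hzj : |z| ≤ j := abs_le_of_sq_le_sq (by nlinarith [sq_nonneg δ]) hj.le
  have hδj : δ ≤ j := by nlinarith [sq_nonneg z, sq_nonneg (j - δ)]
  have hW : 0 < e * φ * j / w ^ 2 := by positivity
  have t1 : e * φ * j / w ^ 2 * (Ax + b') ≤ e * φ * j / w ^ 2 * (2 * k) :=
    mul_le_mul_of_nonneg_left (by linarith [le_abs_self Ax, le_abs_self b']) hW.le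
  have t2 : -(e * b * j / w ^ 2) ≤ e * φ * j / w ^ 2 * k := by
    have : e * j / w ^ 2 * (-b) ≤ e * j / w ^ 2 * (k * φ) :=
      mul_le_mul_of_nonneg_left (by linarith [neg_abs_le b]) (by positivity)
    calc _ = e * j / w ^ 2 * (-b) := by ring
      _ ≤ _ := this
      _ = _ := by ring
  have t3 : e * φ * z / (j * w ^ 2) * X ≤ e * φ * j / w ^ 2 * k + S := by
    have h1 : z * X ≤ j * |X| := by
      calc z * X ≤ |z * X| := le_abs_self _
        _ = |z| * |X| := abs_mul _ _
        _ ≤ _ := mul_le_mul_of_nonneg_right hzj (abs_nonneg _)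
    calc e * φ * z / (j * w ^ 2) * X = e * φ / (j * w ^ 2) * (z * X) := by ring
      _ ≤ e * φ / (j * w ^ 2) * (j * |X|) := mul_le_mul_of_nonneg_left h1 (by positivity)
      _ = e / w ^ 2 * (φ * |X|) := by field_simp
      _ ≤ e / w ^ 2 * (k * φ * |z| + w ^ 2 * S) :=
        mul_le_mul_of_nonneg_left hX (by positivity)
      _ = e / w ^ 2 * (k * φ) * |z| + e * S := by field_simp
      _ ≤ e / w ^ 2 * (k * φ) * j + 1 * S := by gcongr
      _ = _ := by ring
  have t4 : -(e * φ * r * z ^ 2 / (j * w ^ 2)) ≤ e * φ * j / w ^ 2 * k := by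
    have h1 : -r * z ^ 2 ≤ k * j ^ 2 := by
      have : -r * z ^ 2 ≤ k * z ^ 2 :=
        mul_le_mul_of_nonneg_right (by linarith [neg_abs_le r]) (sq_nonneg z)
      nlinarith [mul_nonneg hk (sq_nonneg δ)]
    calc _ = e * φ / (j * w ^ 2) * (-r * z ^ 2) := by ring
      _ ≤ e * φ / (j * w ^ 2) * (k * j ^ 2) := mul_le_mul_of_nonneg_left h1 (by positivity)
      _ = _ := by field_simp
  have t5 : -(2 * e * φ * D * δ ^ 2 / (j * w ^ 3)) ≤ δ * (2 * φ * |D| / w ^ 3) := by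
    have h1 : -D * δ ^ 2 ≤ |D| * (δ * j) := by
      calc -D * δ ^ 2 ≤ |D| * δ ^ 2 :=
            mul_le_mul_of_nonneg_right (neg_le_abs D) (sq_nonneg δ)
        _ ≤ _ := mul_le_mul_of_nonneg_left (by nlinarith) (abs_nonneg D)
    calc _ = 2 * e * φ / (j * w ^ 3) * (-D * δ ^ 2) := by ring
      _ ≤ 2 * e * φ / (j * w ^ 3) * (|D| * (δ * j)) :=
        mul_le_mul_of_nonneg_left h1 (by positivity)
      _ = e * (δ * (2 * φ * |D| / w ^ 3)) := by field_simp
      _ ≤ 1 * (δ * (2 * φ * |D| / w ^ 3)) :=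
        mul_le_mul_of_nonneg_right he1 (by positivity)
      _ = _ := one_mul _
  have t6 : 0 ≤ e * φ * zy ^ 2 * δ ^ 2 / j ^ 3 := by positivity
  have t7 : e * (φ * |z| / w ^ 2) ≤ e * φ * j / w ^ 2 := by
    calc _ = e * φ / w ^ 2 * |z| := by ring
      _ ≤ e * φ / w ^ 2 * j := mul_le_mul_of_nonneg_left hzj (by positivity)
      _ = _ := by ring
  linarith [hid, t1, t2, t3, t4, t5, t6, t7]

end WeightedEstimate

section WeightedL1

theorem hasDerivAt_sqrt_sq_add_sq {f : ℝ → ℝ} {f' x δ : ℝ} (hf : HasDerivAt f f' x)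
    (hδ : 0 < δ) :
    HasDerivAt (fun s => √(f s ^ 2 + δ ^ 2)) (f x * f' / √(f x ^ 2 + δ ^ 2)) x := by
  have h1 : HasDerivAt (fun s => f s ^ 2 + δ ^ 2) (2 * f x * f') x := by
    simpa using (hf.pow 2).add_const (δ ^ 2)
  have h2 := h1.sqrt (by positivity)
  convert h2 using 1
  have : √(f x ^ 2 + δ ^ 2) ≠ 0 := by positivity
  field_simp

theorem hasDerivAt_mul_div_sq {a j w : ℝ → ℝ} {a' j' w' x : ℝ} (ha : HasDerivAt a a' x)
    (hj : HasDerivAt j j' x) (hw : HasDerivAt w w' x) (hw0 : w x ≠ 0) :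
    HasDerivAt (fun s => a s * j s / w s ^ 2)
      (a' * j x / w x ^ 2 + a x * (j' / w x ^ 2 - 2 * j x * w' / w x ^ 3)) x := by
  have h1 : HasDerivAt (fun s => w s ^ 2) (2 * w x * w') x := by
    simpa using hw.fun_pow 2
  have h2 := (ha.mul hj).div h1 (pow_ne_zero 2 hw0)
  refine h2.congr_deriv ?_
  simp only [Pi.mul_apply]
  field_simp
  ring

theorem Smooth3.continuous {u : ℝ → ℝ → ℝ → ℝ} (hu : Smooth3 u) :
    Continuous (fun p : ℝ × ℝ × ℝ => u p.1 p.2.1 p.2.2) :=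
  ContDiff.continuous (𝕜 := ℝ) hu

theorem sqrt_sq_add_sq_le {z δ : ℝ} (hδ : 0 ≤ δ) : √(z ^ 2 + δ ^ 2) ≤ |z| + δ := by
  rw [Real.sqrt_le_left (by positivity)]
  nlinarith [sq_abs z, mul_nonneg (abs_nonneg z) hδ]

/-- Continuity of the divergence components of the weighted flux. -/
theorem continuousOn_weighted_flux {X : Type*} [TopologicalSpace X] {Q : Set X}
    {e φ w z zx zy zt zyy wx wy wt A Ax b b' S : X → ℝ} {δ K : ℝ} (hδ : 0 < δ)
    (he : ContinuousOn e Q) (hφ : ContinuousOn φ Q) (hw : ContinuousOn w Q)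
    (hz : ContinuousOn z Q) (hzx : ContinuousOn zx Q) (hzy : ContinuousOn zy Q)
    (hzt : ContinuousOn zt Q) (hzyy : ContinuousOn zyy Q) (hwx : ContinuousOn wx Q)
    (hwy : ContinuousOn wy Q) (hwt : ContinuousOn wt Q) (hA : ContinuousOn A Q)
    (hAx : ContinuousOn Ax Q) (hb : ContinuousOn b Q) (hb' : ContinuousOn b' Q)
    (hS : ContinuousOn S Q) (hw0 : ∀ p ∈ Q, w p ≠ 0) :
    ContinuousOn (fun p => e p * φ p * (Ax p * √(z p ^ 2 + δ ^ 2) / w p ^ 2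
        + A p * (z p * zx p / (√(z p ^ 2 + δ ^ 2) * w p ^ 2)
          - 2 * √(z p ^ 2 + δ ^ 2) * wx p / w p ^ 3))) Q ∧
    ContinuousOn (fun p => e p * (b' p * φ p * √(z p ^ 2 + δ ^ 2) / w p ^ 2
        - b p * √(z p ^ 2 + δ ^ 2) / w p ^ 2
        + b p * φ p * (z p * zy p / (√(z p ^ 2 + δ ^ 2) * w p ^ 2)
          - 2 * √(z p ^ 2 + δ ^ 2) * wy p / w p ^ 3)
        - φ p * ((zy p ^ 2 + z p * zyy p) / √(z p ^ 2 + δ ^ 2)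
          - z p ^ 2 * zy p ^ 2 / √(z p ^ 2 + δ ^ 2) ^ 3))) Q ∧
    ContinuousOn (fun p => e p * φ p * (-K * √(z p ^ 2 + δ ^ 2) / w p ^ 2
        + z p * zt p / (√(z p ^ 2 + δ ^ 2) * w p ^ 2)
        - 2 * √(z p ^ 2 + δ ^ 2) * wt p / w p ^ 3)) Q ∧
    ContinuousOn (fun p => e p * (φ p * |z p| / w p ^ 2) - S p) Q ∧
    ContinuousOn (fun p => 2 * φ p * |wt p + A p * wx p + b p * wy p| / w p ^ 3) Q ∧
    ContinuousOn (fun p => φ p / w p ^ 2) Q ∧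
    ContinuousOn (fun p => A p * φ p / w p ^ 2) Q ∧
    ContinuousOn (fun p => φ p * b p / w p ^ 2) Q := by
  have hj0 : ∀ p ∈ Q, √(z p ^ 2 + δ ^ 2) ≠ 0 := fun p _ => by positivity
  have hw2 : ∀ p ∈ Q, w p ^ 2 ≠ 0 := fun p hp => pow_ne_zero _ (hw0 p hp)
  have hw3 : ∀ p ∈ Q, w p ^ 3 ≠ 0 := fun p hp => pow_ne_zero _ (hw0 p hp)
  have hj3 : ∀ p ∈ Q, √(z p ^ 2 + δ ^ 2) ^ 3 ≠ 0 := fun p hp => pow_ne_zero _ (hj0 p hp)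
  have hjw : ∀ p ∈ Q, √(z p ^ 2 + δ ^ 2) * w p ^ 2 ≠ 0 :=
    fun p hp => mul_ne_zero (hj0 p hp) (hw2 p hp)
  refine ⟨?_, ?_, ?_, ?_, ?_, ?_, ?_, ?_⟩ <;> fun_prop (disch := assumption)

variable {L T ε k B : ℝ} {w z A Ax b b' r S : ℝ → ℝ → ℝ → ℝ}

set_option maxHeartbeats 1000000 in
/-- Weighted `L¹` estimate for solutions of the linearized degenerate parabolic equation. -/
theorem integral_weighted_abs_le (hL : 0 < L) (hT : 0 < T) (hε : ε ∈ Ioo (0:ℝ) 1) (hk : 0 ≤ k)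
    (hw : Smooth3 w) (hz : Smooth3 z)
    (hw0 : ∀ x ∈ Icc 0 L, ∀ y ∈ Icc (0:ℝ) 1, ∀ t ∈ Icc 0 T, 0 < w x y t)
    (hA : ∀ x ∈ Icc 0 L, ∀ y ∈ Icc (0:ℝ) 1, ∀ t ∈ Icc 0 T,
      HasDerivAt (fun s => A s y t) (Ax x y t) x)
    (hb : ∀ x ∈ Icc 0 L, ∀ y ∈ Icc (0:ℝ) 1, ∀ t ∈ Icc 0 T,
      HasDerivAt (fun s => b x s t) (b' x y t) y)
    (hcA : ContinuousOn (fun p : ℝ × ℝ × ℝ => A p.1 p.2.1 p.2.2) (closedCylinder L T))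
    (hcAx : ContinuousOn (fun p : ℝ × ℝ × ℝ => Ax p.1 p.2.1 p.2.2) (closedCylinder L T))
    (hcb : ContinuousOn (fun p : ℝ × ℝ × ℝ => b p.1 p.2.1 p.2.2) (closedCylinder L T))
    (hcb' : ContinuousOn (fun p : ℝ × ℝ × ℝ => b' p.1 p.2.1 p.2.2) (closedCylinder L T))
    (hcS : ContinuousOn (fun p : ℝ × ℝ × ℝ => S p.1 p.2.1 p.2.2) (closedCylinder L T))
    (hS : ∀ x ∈ Icc 0 L, ∀ y ∈ Icc (0:ℝ) 1, ∀ t ∈ Icc 0 T, 0 ≤ S x y t)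
    (hA0 : ∀ x ∈ Icc 0 L, ∀ y ∈ Icc (0:ℝ) 1, ∀ t ∈ Icc 0 T, 0 ≤ A x y t)
    (hAxk : ∀ x ∈ Icc 0 L, ∀ y ∈ Icc (0:ℝ) 1, ∀ t ∈ Icc 0 T, |Ax x y t| ≤ k)
    (hb'k : ∀ x ∈ Icc 0 L, ∀ y ∈ Icc (0:ℝ) 1, ∀ t ∈ Icc 0 T, |b' x y t| ≤ k)
    (hbk : ∀ x ∈ Icc 0 L, ∀ y ∈ Icc (0:ℝ) 1, ∀ t ∈ Icc 0 T, |b x y t| ≤ k * (1 - y))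
    (hrk : ∀ x ∈ Icc 0 L, ∀ y ∈ Icc (0:ℝ) 1, ∀ t ∈ Icc 0 T, |r x y t| ≤ k)
    (heq : ∀ x ∈ Ioo 0 L, ∀ y ∈ Ioo (0:ℝ) 1, ∀ t ∈ Ioo 0 T,
      (1 - y + ε) * |Dt z x y t - w x y t ^ 2 * Dy (Dy z) x y t + A x y t * Dx z x y t
        + b x y t * Dy z x y t + (r x y t - 2 * (Dt w x y t + A x y t * Dx w x y t
          + b x y t * Dy w x y t) / w x y t) * z x y t|
        ≤ k * (1 - y + ε) * |z x y t| + w x y t ^ 2 * S x y t)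
    (hinit : ∀ x ∈ Ioo 0 L, ∀ y ∈ Ioo (0:ℝ) 1, (1 - y + ε) * |z x y 0| / w x y 0 ^ 2 ≤ B)
    (hleft : ∀ y ∈ Ioo (0:ℝ) 1, ∀ t ∈ Ioo 0 T,
      A 0 y t * (1 - y + ε) * |z 0 y t| / w 0 y t ^ 2 ≤ B)
    (htop : ∀ x ∈ Ioo 0 L, ∀ t ∈ Ioo 0 T, z x 1 t = 0)
    (hb0 : ∀ x ∈ Ioo 0 L, ∀ t ∈ Ioo 0 T, 0 ≤ b x 0 t)
    (hbot : ∀ x ∈ Ioo 0 L, ∀ t ∈ Ioo 0 T,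
      |Dy z x 0 t - b x 0 t * z x 0 t / w x 0 t ^ 2| ≤ B) :
    ∫ p in QT L T, (1 - p.2.1 + ε) * |z p.1 p.2.1 p.2.2| / w p.1 p.2.1 p.2.2 ^ 2
      ≤ exp ((5 * k + 1) * T)
        * ((∫ p in QT L T, S p.1 p.2.1 p.2.2) + B * (T + 2 * (L * T) + L)) := by
  have hε0 := hε.1
  have hε1 := hε.2
  have hcont : ∀ δ : ℝ, 0 < δ → _ := fun δ hδ =>
    continuousOn_weighted_flux (Q := closedCylinder L T)
      (e := fun p => exp (-(5 * k + 1) * p.2.2)) (φ := fun p => 1 - p.2.1 + ε)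
      (K := 5 * k + 1) hδ (by fun_prop) (by fun_prop) hw.continuous.continuousOn
      hz.continuous.continuousOn hz.Dx.continuous.continuousOn hz.Dy.continuous.continuousOn
      hz.Dt.continuous.continuousOn hz.Dy.Dy.continuous.continuousOn
      hw.Dx.continuous.continuousOn hw.Dy.continuous.continuousOn hw.Dt.continuous.continuousOn
      hcA hcAx hcb hcb' hcS (fun p hp => (hw0 _ hp.1 _ hp.2.1 _ hp.2.2).ne')
  have hK := isCompact_closedCylinder L T
  obtain ⟨-, -, -, -, h5, h6, h7, h8⟩ := hcont 1 one_pos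
  obtain ⟨E₁, hE₁⟩ := hK.exists_bound_of_continuousOn h5
  obtain ⟨E₂, hE₂⟩ := hK.exists_bound_of_continuousOn h6
  obtain ⟨E₃, hE₃⟩ := hK.exists_bound_of_continuousOn h7
  obtain ⟨E₄, hE₄⟩ := hK.exists_bound_of_continuousOn h8
  have hmain : ∀ δ : ℝ, 0 < δ →
      ∫ p in QT L T, (exp (-(5 * k + 1) * p.2.2) * ((1 - p.2.1 + ε) * |z p.1 p.2.1 p.2.2|
        / w p.1 p.2.1 p.2.2 ^ 2) - S p.1 p.2.1 p.2.2)
      ≤ (δ * E₁) * (L * T) + (B + δ * E₃) * T + (2 * B + δ * (E₄ + 1)) * (L * T)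
        + (B + δ * E₂) * L := by
    intro δ hδ
    obtain ⟨c1, c2, c3, c4, -⟩ := hcont δ hδ
    refine integral_QT_le_of_add_div_le hL hT
      (h := fun x y t => exp (-(5 * k + 1) * t) * ((1 - y + ε) * |z x y t| / w x y t ^ 2)
        - S x y t)
      (F₁ := fun x y t => exp (-(5 * k + 1) * t) * (1 - y + ε)
        * (A x y t * √(z x y t ^ 2 + δ ^ 2) / w x y t ^ 2))
      (F₂ := fun x y t => exp (-(5 * k + 1) * t)
        * ((b x y t * (1 - y + ε)) * √(z x y t ^ 2 + δ ^ 2) / w x y t ^ 2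
          - (1 - y + ε) * (z x y t * Dy z x y t / √(z x y t ^ 2 + δ ^ 2))
          - √(z x y t ^ 2 + δ ^ 2)))
      (F₃ := fun x y t => (1 - y + ε)
        * (exp (-(5 * k + 1) * t) * √(z x y t ^ 2 + δ ^ 2) / w x y t ^ 2))
      (G₁ := fun x y t => exp (-(5 * k + 1) * t) * (1 - y + ε)
        * (Ax x y t * √(z x y t ^ 2 + δ ^ 2) / w x y t ^ 2
          + A x y t * (z x y t * Dx z x y t / (√(z x y t ^ 2 + δ ^ 2) * w x y t ^ 2)
            - 2 * √(z x y t ^ 2 + δ ^ 2) * Dx w x y t / w x y t ^ 3)))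
      (G₂ := fun x y t => exp (-(5 * k + 1) * t)
        * (b' x y t * (1 - y + ε) * √(z x y t ^ 2 + δ ^ 2) / w x y t ^ 2
          - b x y t * √(z x y t ^ 2 + δ ^ 2) / w x y t ^ 2
          + b x y t * (1 - y + ε) * (z x y t * Dy z x y t / (√(z x y t ^ 2 + δ ^ 2) * w x y t ^ 2)
            - 2 * √(z x y t ^ 2 + δ ^ 2) * Dy w x y t / w x y t ^ 3)
          - (1 - y + ε) * ((Dy z x y t ^ 2 + z x y t * Dy (Dy z) x y t) / √(z x y t ^ 2 + δ ^ 2)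
            - z x y t ^ 2 * Dy z x y t ^ 2 / √(z x y t ^ 2 + δ ^ 2) ^ 3)))
      (G₃ := fun x y t => exp (-(5 * k + 1) * t) * (1 - y + ε)
        * (-(5 * k + 1) * √(z x y t ^ 2 + δ ^ 2) / w x y t ^ 2
          + z x y t * Dt z x y t / (√(z x y t ^ 2 + δ ^ 2) * w x y t ^ 2)
          - 2 * √(z x y t ^ 2 + δ ^ 2) * Dt w x y t / w x y t ^ 3))
      ?_ ?_ ?_ c1 c2 c3 c4 ?_ ?_ ?_ ?_
    · intro x hx y hy t ht
      have hw' := (hw0 x hx y hy t ht).ne'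
      refine ((hasDerivAt_mul_div_sq (hA x hx y hy t ht)
        (hasDerivAt_sqrt_sq_add_sq (hz.hasDerivAt_x x y t) hδ) (hw.hasDerivAt_x x y t)
        hw').const_mul _).congr_deriv ?_
      have : √(z x y t ^ 2 + δ ^ 2) ≠ 0 := by positivity
      simp only [div_div]
    · intro x hx y hy t ht
      have hw' := (hw0 x hx y hy t ht).ne'
      have hφ : HasDerivAt (fun s : ℝ => 1 - s + ε) (-1) y :=
        ((hasDerivAt_id y).const_sub 1).add_const ε
      have hj := hasDerivAt_sqrt_sq_add_sq (hz.hasDerivAt_y x y t) hδ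
      have hj0 : √(z x y t ^ 2 + δ ^ 2) ≠ 0 := by positivity
      have h1 := hasDerivAt_mul_div_sq ((hb x hx y hy t ht).mul hφ) hj (hw.hasDerivAt_y x y t) hw'
      have h2 := hφ.mul (((hz.hasDerivAt_y x y t).mul (hz.Dy.hasDerivAt_y x y t)).div hj hj0)
      refine (((h1.sub h2).sub hj).const_mul (exp (-(5 * k + 1) * t))).congr_deriv ?_
      simp only [Pi.mul_apply, Pi.div_apply]
      field_simp
      ring
    · intro x hx y hy t ht
      have hw' := (hw0 x hx y hy t ht).ne'
      have he : HasDerivAt (fun s => exp (-(5 * k + 1) * s))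
          (exp (-(5 * k + 1) * t) * -(5 * k + 1)) t := by
        simpa using ((hasDerivAt_id t).const_mul (-(5 * k + 1))).exp
      refine ((hasDerivAt_mul_div_sq he
        (hasDerivAt_sqrt_sq_add_sq (hz.hasDerivAt_t x y t) hδ) (hw.hasDerivAt_t x y t)
        hw').const_mul _).congr_deriv ?_
      simp only [div_div]
      ring
    · intro x hx y hy t ht
      have hx' := Ioo_subset_Icc_self hx
      have hy' := Ioo_subset_Icc_self hy
      have ht' := Ioo_subset_Icc_self ht
      have hφ : 0 < 1 - y + ε := by linarith [hy.2]
      refine (weighted_flux_le (exp_pos _) (exp_le_one_iff.2 ?_) hφ (hw0 x hx' y hy' t ht')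
        (by positivity) (Real.sq_sqrt (by positivity)) hδ (hS x hx' y hy' t ht') hk
        (hAxk x hx' y hy' t ht') (hb'k x hx' y hy' t ht') ?_ (hrk x hx' y hy' t ht')
        (heq x hx y hy t ht)).trans ?_
      · nlinarith [ht.1]
      · exact (hbk x hx' y hy' t ht').trans (by gcongr; linarith)
      · exact mul_le_mul_of_nonneg_left
          ((le_abs_self _).trans (hE₁ (x, y, t) ⟨hx', hy', ht'⟩)) hδ.le
    · intro y hy t ht
      have hy' := Ioo_subset_Icc_self hy
      have ht' := Ioo_subset_Icc_self ht
      have hφ : 0 < 1 - y + ε := by linarith [hy.2]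
      have h0 : (0:ℝ) ∈ Icc 0 L := ⟨le_rfl, hL.le⟩
      have hLL : L ∈ Icc 0 L := ⟨hL.le, le_rfl⟩
      have hA00 := hA0 0 h0 y hy' t ht'
      have hw00 := hw0 0 h0 y hy' t ht'
      have hAL := hA0 L hLL y hy' t ht'
      have hL0 : 0 ≤ exp (-(5 * k + 1) * t) * (1 - y + ε)
        * (A L y t * √(z L y t ^ 2 + δ ^ 2) / w L y t ^ 2) := by positivity
      have he1 : exp (-(5 * k + 1) * t) ≤ 1 := exp_le_one_iff.2 (by nlinarith [ht.1])
      have hb3 : A 0 y t * (1 - y + ε) / w 0 y t ^ 2 ≤ E₃ :=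
        (le_abs_self _).trans (hE₃ (0, y, t) ⟨h0, hy', ht'⟩)
      have : exp (-(5 * k + 1) * t) * (1 - y + ε)
          * (A 0 y t * √(z 0 y t ^ 2 + δ ^ 2) / w 0 y t ^ 2) ≤ B + δ * E₃ := by
        calc _ = exp (-(5 * k + 1) * t) * (A 0 y t * (1 - y + ε) / w 0 y t ^ 2
              * √(z 0 y t ^ 2 + δ ^ 2)) := by ring
          _ ≤ 1 * (A 0 y t * (1 - y + ε) / w 0 y t ^ 2 * (|z 0 y t| + δ)) := by
            gcongr
            exact sqrt_sq_add_sq_le hδ.le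
          _ = A 0 y t * (1 - y + ε) * |z 0 y t| / w 0 y t ^ 2
              + δ * (A 0 y t * (1 - y + ε) / w 0 y t ^ 2) := by ring
          _ ≤ _ := by
            have := hleft y hy t ht
            gcongr
      linarith
    · intro x hx t ht
      have hx' := Ioo_subset_Icc_self hx
      have ht' := Ioo_subset_Icc_self ht
      have h0 : (0:ℝ) ∈ Icc (0:ℝ) 1 := ⟨le_rfl, zero_le_one⟩
      have h1 : (1:ℝ) ∈ Icc (0:ℝ) 1 := ⟨zero_le_one, le_rfl⟩
      have hb1 : b x 1 t = 0 := by
        have := hbk x hx' 1 h1 t ht'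
        simpa using this
      have hz1 := htop x hx t ht
      have hs : √(δ ^ 2) = δ := Real.sqrt_sq hδ.le
      have he0 := exp_pos (-(5 * k + 1) * t)
      have he1 : exp (-(5 * k + 1) * t) ≤ 1 := exp_le_one_iff.2 (by nlinarith [ht.1])
      have hw00 := hw0 x hx' 0 h0 t ht'
      have hb4 : (1 - 0 + ε) * b x 0 t / w x 0 t ^ 2 ≤ E₄ :=
        (le_abs_self _).trans (hE₄ (x, 0, t) ⟨hx', h0, ht'⟩)
      have hb00 := hb0 x hx t ht
      have hβ := hbot x hx t ht
      simp only [hb1, hz1, zero_mul, zero_div, mul_zero, zero_sub, ne_eq, OfNat.ofNat_ne_zero,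
        not_false_eq_true, zero_pow, zero_add, hs, sub_zero] at hb4 ⊢
      generalize exp (-(5 * k + 1) * t) = e at *
      generalize hβd : Dy z x 0 t - b x 0 t * z x 0 t / w x 0 t ^ 2 = β at *
      have hzy : Dy z x 0 t = β + b x 0 t * z x 0 t / w x 0 t ^ 2 := by linarith
      rw [hzy]
      have hjp : 0 < √(z x 0 t ^ 2 + δ ^ 2) := by positivity
      have hjz : √(z x 0 t ^ 2 + δ ^ 2) ^ 2 = z x 0 t ^ 2 + δ ^ 2 := Real.sq_sqrt (by positivity)
      generalize √(z x 0 t ^ 2 + δ ^ 2) = j at *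
      generalize z x 0 t = ζ at *
      generalize b x 0 t = b₀ at *
      generalize w x 0 t = w₀ at *
      have hzj : |ζ| ≤ j := abs_le_of_sq_le_sq (by nlinarith [sq_nonneg δ]) hjp.le
      have hδj : δ ≤ j := by nlinarith [sq_nonneg ζ]
      have hid : b₀ * (1 + ε) * j / w₀ ^ 2 - (1 + ε) * (ζ * (β + b₀ * ζ / w₀ ^ 2) / j) - j
          = (1 + ε) * b₀ / w₀ ^ 2 * (δ ^ 2 / j) + (1 + ε) * (-(ζ * β) / j) - j := by
        have : δ ^ 2 = j ^ 2 - ζ ^ 2 := by linarith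
        rw [this]
        field_simp
        ring
      have q1 : δ ^ 2 / j ≤ δ := by
        rw [div_le_iff₀ hjp]; nlinarith
      have q2 : -(ζ * β) / j ≤ B := by
        rw [div_le_iff₀ hjp]
        calc -(ζ * β) ≤ |ζ * β| := neg_le_abs _
          _ = |β| * |ζ| := by rw [abs_mul, mul_comm]
          _ ≤ B * j := mul_le_mul hβ hzj (abs_nonneg _) ((abs_nonneg _).trans hβ)
      have hB0 : 0 ≤ B := (abs_nonneg _).trans hβ
      have q3 : (1 + ε) * b₀ / w₀ ^ 2 * (δ ^ 2 / j) ≤ E₄ * δ := by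
        have : 0 ≤ (1 + ε) * b₀ / w₀ ^ 2 := by positivity
        exact mul_le_mul hb4 q1 (by positivity) (this.trans hb4)
      have q4 : (1 + ε) * (-(ζ * β) / j) ≤ 2 * B := by
        calc (1 + ε) * (-(ζ * β) / j) ≤ (1 + ε) * B :=
              mul_le_mul_of_nonneg_left q2 (by linarith)
          _ ≤ 2 * B := by nlinarith
      have hE40 : 0 ≤ E₄ := le_trans (by positivity) hb4
      have q5 : b₀ * (1 + ε) * j / w₀ ^ 2 - (1 + ε) * (ζ * (β + b₀ * ζ / w₀ ^ 2) / j) - j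
          ≤ E₄ * δ + 2 * B := by rw [hid]; linarith
      have q6 : e * (b₀ * (1 + ε) * j / w₀ ^ 2 - (1 + ε) * (ζ * (β + b₀ * ζ / w₀ ^ 2) / j) - j)
          ≤ E₄ * δ + 2 * B := by
        calc _ ≤ e * (E₄ * δ + 2 * B) := mul_le_mul_of_nonneg_left q5 he0.le
          _ ≤ 1 * (E₄ * δ + 2 * B) := mul_le_mul_of_nonneg_right he1 (by positivity)
          _ = _ := one_mul _
      nlinarith
    · intro x hx y hy
      have hx' := Ioo_subset_Icc_self hx
      have hy' := Ioo_subset_Icc_self hy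
      have h0 : (0:ℝ) ∈ Icc 0 T := ⟨le_rfl, hT.le⟩
      have hφ : 0 < 1 - y + ε := by linarith [hy.2]
      have hT0 : 0 ≤ (1 - y + ε)
        * (exp (-(5 * k + 1) * T) * √(z x y T ^ 2 + δ ^ 2) / w x y T ^ 2) := by positivity
      have hb2 : (1 - y + ε) / w x y 0 ^ 2 ≤ E₂ :=
        (le_abs_self _).trans (hE₂ (x, y, 0) ⟨hx', hy', h0⟩)
      have : (1 - y + ε) * (exp (-(5 * k + 1) * 0) * √(z x y 0 ^ 2 + δ ^ 2) / w x y 0 ^ 2)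
          ≤ B + δ * E₂ := by
        calc _ = (1 - y + ε) / w x y 0 ^ 2 * √(z x y 0 ^ 2 + δ ^ 2) := by simp; ring
          _ ≤ (1 - y + ε) / w x y 0 ^ 2 * (|z x y 0| + δ) := by
            gcongr
            exact sqrt_sq_add_sq_le hδ.le
          _ = (1 - y + ε) * |z x y 0| / w x y 0 ^ 2 + δ * ((1 - y + ε) / w x y 0 ^ 2) := by ring
          _ ≤ _ := by
            have := hinit x hx y hy
            gcongr
      linarith
  obtain ⟨-, -, -, c4, -⟩ := hcont 1 one_pos
  have hlim : ∫ p in QT L T, (exp (-(5 * k + 1) * p.2.2) * ((1 - p.2.1 + ε)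
      * |z p.1 p.2.1 p.2.2| / w p.1 p.2.1 p.2.2 ^ 2) - S p.1 p.2.1 p.2.2)
      ≤ B * (T + 2 * (L * T) + L) := by
    refine le_of_forall_pos_le_add fun η hη => ?_
    set E := |E₁ * (L * T) + E₃ * T + (E₄ + 1) * (L * T) + E₂ * L| with hE
    have hE0 : 0 < E + 1 := by positivity
    refine (hmain (η / (E + 1)) (by positivity)).trans ?_
    have h1 : η / (E + 1) * (E₁ * (L * T) + E₃ * T + (E₄ + 1) * (L * T) + E₂ * L) ≤ η := by
      calc _ ≤ η / (E + 1) * (E + 1) :=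
            mul_le_mul_of_nonneg_left ((le_abs_self _).trans (by linarith)) (by positivity)
        _ = η := by field_simp
    linarith
  have hcφ : ContinuousOn (fun p : ℝ × ℝ × ℝ => (1 - p.2.1 + ε) * |z p.1 p.2.1 p.2.2|
      / w p.1 p.2.1 p.2.2 ^ 2) (closedCylinder L T) :=
    (((by fun_prop : Continuous fun p : ℝ × ℝ × ℝ => 1 - p.2.1 + ε).mul
      hz.continuous.abs).continuousOn).div (hw.continuous.pow 2).continuousOn
      (fun p hp => pow_ne_zero _ (hw0 _ hp.1 _ hp.2.1 _ hp.2.2).ne')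
  have hlow : ∫ p in QT L T, (exp (-(5 * k + 1) * T) * ((1 - p.2.1 + ε)
      * |z p.1 p.2.1 p.2.2| / w p.1 p.2.1 p.2.2 ^ 2) - S p.1 p.2.1 p.2.2)
      ≤ B * (T + 2 * (L * T) + L) := by
    refine le_trans (setIntegral_mono_on
      (integrableOn_QT ((continuousOn_const.mul hcφ).sub hcS)) (integrableOn_QT c4)
      (measurableSet_QT L T) fun p hp => ?_) hlim
    have : 0 < 1 - p.2.1 + ε := by linarith [hp.2.1.2]
    have ht := hp.2.2.2.le
    have hle : -(5 * k + 1) * T ≤ -(5 * k + 1) * p.2.2 := by nlinarith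
    gcongr
  have hint : IntegrableOn (fun p : ℝ × ℝ × ℝ => exp (-(5 * k + 1) * T) * ((1 - p.2.1 + ε)
      * |z p.1 p.2.1 p.2.2| / w p.1 p.2.1 p.2.2 ^ 2)) (QT L T) :=
    integrableOn_QT (continuousOn_const.mul hcφ)
  rw [integral_sub hint (integrableOn_QT hcS), integral_const_mul] at hlow
  have hee : exp ((5 * k + 1) * T) * exp (-(5 * k + 1) * T) = 1 := by
    rw [← exp_add, ← add_mul, add_neg_cancel, zero_mul, exp_zero]
  calc _ = exp ((5 * k + 1) * T) * (exp (-(5 * k + 1) * T) * ∫ p in QT L T, (1 - p.2.1 + ε)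
        * |z p.1 p.2.1 p.2.2| / w p.1 p.2.1 p.2.2 ^ 2) := by rw [← mul_assoc, hee, one_mul]
    _ ≤ _ := mul_le_mul_of_nonneg_left (by linarith) (exp_pos _).le

end WeightedL1

section Coefficients

variable {n n' U U' M : ℝ}

theorem abs_div_le_sq (hM : 0 < M) (hn : |n| ≤ M) (hU : M⁻¹ ≤ U) : |n / U| ≤ M ^ 2 := by
  have hU0 : 0 < U := (inv_pos.2 hM).trans_le hU
  rw [abs_div, abs_of_pos hU0, div_le_iff₀ hU0]
  have : 1 ≤ M * U := by
    calc (1:ℝ) = M * M⁻¹ := (mul_inv_cancel₀ hM.ne').symm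
      _ ≤ _ := by gcongr
  nlinarith

theorem abs_deriv_quotient_le (hM : 0 < M) (hn : |n| ≤ M) (hn' : |n'| ≤ M) (hU : M⁻¹ ≤ U)
    (hU' : |U'| ≤ M) : |(n' * U - n * U') / U ^ 2| ≤ M ^ 2 + M ^ 4 := by
  have hU0 : 0 < U := (inv_pos.2 hM).trans_le hU
  have h : (n' * U - n * U') / U ^ 2 = n' / U - n / U * (U' / U) := by field_simp
  rw [h]
  calc _ ≤ |n' / U| + |n / U * (U' / U)| := abs_sub _ _
    _ = |n' / U| + |n / U| * |U' / U| := by rw [abs_mul]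
    _ ≤ M ^ 2 + M ^ 2 * M ^ 2 := by
      gcongr
      · exact abs_div_le_sq hM hn' hU
      · exact abs_div_le_sq hM hn hU
      · exact abs_div_le_sq hM hU' hU
    _ = _ := by ring

end Coefficients

theorem closedCylinder_subset_closure_QT {L T : ℝ} (hL : 0 < L) (hT : 0 < T) :
    closedCylinder L T ⊆ closure (QT L T) := by
  rw [QT, closure_prod_eq, closure_prod_eq, closure_Ioo hL.ne, closure_Ioo hT.ne,
    closure_Ioo zero_ne_one]
  exact subset_rfl

/-- A regularized solution together with its data, quantitative bounds by `M ≥ 1`, and two-sided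
bounds by multiples of `1 - y`. -/
structure BoundedSolution (L T M ε : ℝ) (U P u₀ u₁ v₀ : ℝ → ℝ → ℝ) (u : ℝ → ℝ → ℝ → ℝ) :
    Prop where
  hL : 0 < L
  hT : 0 < T
  one_le : 1 ≤ M
  hε : ε ∈ Ioo (0:ℝ) 1
  euler : EulerData L T M U P
  smooth₀ : Smooth2 u₀
  smooth₁ : Smooth2 u₁
  smooth_v : Smooth2 v₀
  bound₀ : C2Bound u₀ (Icc 0 L) (Icc 0 1) M
  bound₁ : C2Bound u₁ (Icc 0 1) (Icc 0 T) M
  bound_v : C2Bound v₀ (Icc 0 L) (Icc 0 T) M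
  sol : RegSolution L T ε U P u₀ u₁ v₀ u
  bounds : ∀ x ∈ Ioo 0 L, ∀ y ∈ Ioo (0:ℝ) 1, ∀ t ∈ Ioo 0 T,
    M⁻¹ * (1 - y) ≤ u x y t ∧ u x y t ≤ M * (1 - y)

namespace BoundedSolution

variable {L T M ε : ℝ} {U P u₀ u₁ v₀ : ℝ → ℝ → ℝ} {u : ℝ → ℝ → ℝ → ℝ} {x y t : ℝ}
  (H : BoundedSolution L T M ε U P u₀ u₁ v₀ u)
include H

theorem M_pos : 0 < M := zero_lt_one.trans_le H.one_le

theorem smooth : Smooth3 u := H.sol.1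

theorem U_pos (hx : x ∈ Icc 0 L) (ht : t ∈ Icc 0 T) : 0 < U x t := H.euler.2.2.1 x hx t ht

theorem inv_le_U (hx : x ∈ Icc 0 L) (ht : t ∈ Icc 0 T) : M⁻¹ ≤ U x t :=
  H.euler.2.2.2.2.2.2.2 x hx t ht

theorem U_bound : C2Bound U (Icc 0 L) (Icc 0 T) M := H.euler.2.2.2.2.2.1

theorem P_bound : C2Bound P (Icc 0 L) (Icc 0 T) M := H.euler.2.2.2.2.2.2.1

theorem le_pow : M ≤ M ^ 4 ∧ M ^ 2 ≤ M ^ 4 ∧ 1 ≤ M ^ 4 :=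
  ⟨le_self_pow₀ H.one_le (by norm_num), pow_le_pow_right₀ H.one_le (by norm_num),
    one_le_pow₀ H.one_le⟩

theorem continuousOn_U_ne : ∀ p ∈ closedCylinder L T, U p.1 p.2.2 ≠ 0 :=
  fun _ hp => (H.U_pos hp.1 hp.2.2).ne'

theorem continuousOn_bcoef :
    ContinuousOn (fun p : ℝ × ℝ × ℝ => bcoef U p.1 p.2.1 p.2.2) (closedCylinder L T) := by
  have h0 := H.continuousOn_U_ne
  have h1 := H.euler.1.continuous_xt.continuousOn (s := closedCylinder L T)
  have h2 := H.euler.1.pd1.continuous_xt.continuousOn (s := closedCylinder L T)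
  have h3 := H.euler.1.pd2.continuous_xt.continuousOn (s := closedCylinder L T)
  have hy : ContinuousOn (fun p : ℝ × ℝ × ℝ => p.2.1) (closedCylinder L T) := by fun_prop
  exact ((continuousOn_const.sub (hy.pow 2)).mul h2).add
    (((continuousOn_const.sub hy).mul h3).div h1 h0)

theorem continuousOn_ccoef :
    ContinuousOn (fun p : ℝ × ℝ × ℝ => ccoef U P p.1 p.2.1 p.2.2) (closedCylinder L T) := by
  have h0 := H.continuousOn_U_ne
  have h1 := H.euler.1.continuous_xt.continuousOn (s := closedCylinder L T)
  have h2 := H.euler.1.pd1.continuous_xt.continuousOn (s := closedCylinder L T)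
  have h3 := H.euler.2.1.pd1.continuous_xt.continuousOn (s := closedCylinder L T)
  have hy : ContinuousOn (fun p : ℝ × ℝ × ℝ => p.2.1) (closedCylinder L T) := by fun_prop
  exact ((continuousOn_const.sub hy).mul h2).sub (h3.div h1 h0)

theorem bounds_closed (hx : x ∈ Icc 0 L) (hy : y ∈ Icc (0:ℝ) 1) (ht : t ∈ Icc 0 T) :
    M⁻¹ * (1 - y) ≤ u x y t ∧ u x y t ≤ M * (1 - y) := by
  have hp : (x, y, t) ∈ closure (QT L T) :=
    closedCylinder_subset_closure_QT H.hL H.hT ⟨hx, hy, ht⟩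
  have hu := H.smooth.continuous
  constructor
  · exact le_on_closure (f := fun p : ℝ × ℝ × ℝ => M⁻¹ * (1 - p.2.1))
      (g := fun p : ℝ × ℝ × ℝ => u p.1 p.2.1 p.2.2)
      (fun p hp => (H.bounds _ hp.1 _ hp.2.1 _ hp.2.2).1) (by fun_prop) hu.continuousOn hp
  · exact le_on_closure (f := fun p : ℝ × ℝ × ℝ => u p.1 p.2.1 p.2.2)
      (g := fun p : ℝ × ℝ × ℝ => M * (1 - p.2.1))
      (fun p hp => (H.bounds _ hp.1 _ hp.2.1 _ hp.2.2).2) hu.continuousOn (by fun_prop) hp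

theorem u_nonneg (hx : x ∈ Icc 0 L) (hy : y ∈ Icc (0:ℝ) 1) (ht : t ∈ Icc 0 T) : 0 ≤ u x y t :=
  le_trans (mul_nonneg (inv_pos.2 H.M_pos).le (by linarith [hy.2]))
    (H.bounds_closed hx hy ht).1

theorem w_pos (hx : x ∈ Icc 0 L) (hy : y ∈ Icc (0:ℝ) 1) (ht : t ∈ Icc 0 T) :
    0 < u x y t + ε := add_pos_of_nonneg_of_pos (H.u_nonneg hx hy ht) H.hε.1

theorem w_bounds (hx : x ∈ Icc 0 L) (hy : y ∈ Icc (0:ℝ) 1) (ht : t ∈ Icc 0 T) :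
    1 - y + ε ≤ M * (u x y t + ε) ∧ u x y t + ε ≤ M * (1 - y + ε) := by
  obtain ⟨h1, h2⟩ := H.bounds_closed hx hy ht
  have hε := H.hε.1
  have hM := H.one_le
  constructor
  · have h3 : M * (M⁻¹ * (1 - y)) ≤ M * u x y t := mul_le_mul_of_nonneg_left h1 H.M_pos.le
    rw [mul_inv_cancel_left₀ H.M_pos.ne'] at h3
    nlinarith
  · nlinarith

theorem pde (hx : x ∈ Icc 0 L) (hy : y ∈ Icc (0:ℝ) 1) (ht : t ∈ Icc 0 T) :
    Dt u x y t - (u x y t + ε) ^ 2 * Dy (Dy u) x y t + (y * U x t + ε) * Dx u x y t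
      + bcoef U x y t * Dy u x y t + ccoef U P x y t * u x y t = 0 := by
  have hs := H.smooth
  have h1 := hs.continuous.continuousOn (s := closedCylinder L T)
  have h2 := hs.Dt.continuous.continuousOn (s := closedCylinder L T)
  have h3 := hs.Dx.continuous.continuousOn (s := closedCylinder L T)
  have h4 := hs.Dy.continuous.continuousOn (s := closedCylinder L T)
  have h5 := hs.Dy.Dy.continuous.continuousOn (s := closedCylinder L T)
  have h6 := H.continuousOn_bcoef
  have h7 := H.continuousOn_ccoef
  have h8 := H.euler.1.continuous_xt.continuousOn (s := closedCylinder L T)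
  have h9 : ContinuousOn (fun p : ℝ × ℝ × ℝ => p.2.1) (closedCylinder L T) := by fun_prop
  have key : EqOn (fun p : ℝ × ℝ × ℝ => Dt u p.1 p.2.1 p.2.2
      - (u p.1 p.2.1 p.2.2 + ε) ^ 2 * Dy (Dy u) p.1 p.2.1 p.2.2
      + (p.2.1 * U p.1 p.2.2 + ε) * Dx u p.1 p.2.1 p.2.2
      + bcoef U p.1 p.2.1 p.2.2 * Dy u p.1 p.2.1 p.2.2
      + ccoef U P p.1 p.2.1 p.2.2 * u p.1 p.2.1 p.2.2) (fun _ => 0) (closedCylinder L T) := by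
    refine EqOn.of_subset_closure (s := QT L T) (fun p hp => ?_)
      (((((h2.sub (((h1.add continuousOn_const).pow 2).mul h5)).add
        (((h9.mul h8).add continuousOn_const).mul h3)).add (h6.mul h4)).add (h7.mul h1)))
      continuousOn_const (QT_subset_closedCylinder L T) (closedCylinder_subset_closure_QT H.hL H.hT)
    have := H.sol.2.1 _ hp.1 _ hp.2.1 _ hp.2.2
    rwa [Dyy_eq_Dy_Dy] at this
  exact key (x := (x, y, t)) ⟨hx, hy, ht⟩

theorem abs_Ux_le (hx : x ∈ Icc 0 L) (ht : t ∈ Icc 0 T) : |pd1 U x t| ≤ M :=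
  (H.U_bound x hx t ht).2.1

theorem abs_Ut_le (hx : x ∈ Icc 0 L) (ht : t ∈ Icc 0 T) : |pd2 U x t| ≤ M :=
  (H.U_bound x hx t ht).2.2.1

theorem abs_bcoef_le (hx : x ∈ Icc 0 L) (hy : y ∈ Icc (0:ℝ) 1) (ht : t ∈ Icc 0 T) :
    |bcoef U x y t| ≤ 4 * M ^ 4 * (1 - y) := by
  have h1 := abs_div_le_sq H.M_pos (H.abs_Ut_le hx ht) (H.inv_le_U hx ht)
  have h2 := H.abs_Ux_le hx ht
  have hp := H.le_pow
  have hy0 : 0 ≤ 1 - y := by linarith [hy.2]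
  have e : bcoef U x y t = (1 - y) * ((1 + y) * pd1 U x t + pd2 U x t / U x t) := by
    unfold bcoef; ring
  rw [e, abs_mul, abs_of_nonneg hy0, mul_comm]
  refine mul_le_mul_of_nonneg_right ?_ hy0
  calc _ ≤ |(1 + y) * pd1 U x t| + |pd2 U x t / U x t| := abs_add_le _ _
    _ = (1 + y) * |pd1 U x t| + |pd2 U x t / U x t| := by
      rw [abs_mul, abs_of_nonneg (by linarith [hy.1])]
    _ ≤ 2 * M + M ^ 2 := by
      have : (1 + y) * |pd1 U x t| ≤ 2 * M :=
        mul_le_mul (by linarith [hy.2]) h2 (abs_nonneg _) (by norm_num)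
      linarith
    _ ≤ _ := by linarith

omit H in
theorem hasDerivAt_bcoef_y :
    HasDerivAt (fun s => bcoef U x s t) (-2 * y * pd1 U x t - pd2 U x t / U x t) y := by
  have h1 : HasDerivAt (fun s : ℝ => 1 - s ^ 2) (-(2 * y)) y := by
    simpa using (hasDerivAt_pow 2 y).const_sub 1
  have h2 : HasDerivAt (fun s : ℝ => 1 - s) (-1) y := (hasDerivAt_id y).const_sub 1
  refine ((h1.mul_const (pd1 U x t)).add
    ((h2.mul_const (pd2 U x t)).div_const (U x t))).congr_deriv ?_
  ring

theorem abs_bcoef_y_le (hx : x ∈ Icc 0 L) (hy : y ∈ Icc (0:ℝ) 1) (ht : t ∈ Icc 0 T) :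
    |-2 * y * pd1 U x t - pd2 U x t / U x t| ≤ 4 * M ^ 4 := by
  have h1 := abs_div_le_sq H.M_pos (H.abs_Ut_le hx ht) (H.inv_le_U hx ht)
  have h2 := H.abs_Ux_le hx ht
  have hp := H.le_pow
  have h3 : |-2 * y * pd1 U x t| ≤ 2 * M := by
    rw [abs_mul, abs_mul, abs_of_nonneg hy.1]
    norm_num
    nlinarith [hy.1, hy.2, abs_nonneg (pd1 U x t)]
  linarith [abs_sub (-2 * y * pd1 U x t) (pd2 U x t / U x t)]

theorem abs_ccoef_le (hx : x ∈ Icc 0 L) (hy : y ∈ Icc (0:ℝ) 1) (ht : t ∈ Icc 0 T) :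
    |ccoef U P x y t| ≤ 4 * M ^ 4 := by
  have h1 := abs_div_le_sq H.M_pos (H.P_bound x hx t ht).2.1 (H.inv_le_U hx ht)
  have h2 := H.abs_Ux_le hx ht
  have hp := H.le_pow
  have h3 : |(1 - y) * pd1 U x t| ≤ M := by
    rw [abs_mul, abs_of_nonneg (by linarith [hy.2])]
    nlinarith [hy.1, hy.2, abs_nonneg (pd1 U x t)]
  have := abs_sub ((1 - y) * pd1 U x t) (pd1 P x t / U x t)
  unfold ccoef
  linarith

theorem A_nonneg (hx : x ∈ Icc 0 L) (hy : y ∈ Icc (0:ℝ) 1) (ht : t ∈ Icc 0 T) :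
    0 ≤ y * U x t + ε :=
  add_nonneg (mul_nonneg hy.1 (H.U_pos hx ht).le) H.hε.1.le

theorem A_le (hx : x ∈ Icc 0 L) (hy : y ∈ Icc (0:ℝ) 1) (ht : t ∈ Icc 0 T) :
    y * U x t + ε ≤ 4 * M ^ 4 := by
  have h1 := (le_abs_self _).trans (H.U_bound x hx t ht).1
  have h2 := H.U_pos hx ht
  have hp := H.le_pow
  nlinarith [hy.1, hy.2, H.hε.2]

theorem hasDerivAt_A_x : HasDerivAt (fun s => y * U s t + ε) (y * pd1 U x t) x :=
  ((H.euler.1.hasDerivAt_fst x t).const_mul y).add_const ε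

omit H in
theorem abs_mul_le_of_mem {a N : ℝ} (hy : y ∈ Icc (0:ℝ) 1) (ha : |a| ≤ N) : |y * a| ≤ N := by
  rw [abs_mul, abs_of_nonneg hy.1]
  nlinarith [hy.2, abs_nonneg a]

theorem abs_A_x_le (hx : x ∈ Icc 0 L) (hy : y ∈ Icc (0:ℝ) 1) (ht : t ∈ Icc 0 T) :
    |y * pd1 U x t| ≤ 4 * M ^ 4 := by
  have := abs_mul_le_of_mem hy (H.abs_Ux_le hx ht)
  linarith [H.le_pow.1, H.M_pos]

theorem bcoef_zero_nonneg (hx : x ∈ Icc 0 L) (ht : t ∈ Icc 0 T) : 0 ≤ bcoef U x 0 t := by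
  have h0 := H.U_pos hx ht
  have h1 := H.euler.2.2.2.1 x hx t ht
  have h2 := H.euler.2.2.2.2.1 x hx t ht
  have e : bcoef U x 0 t = -pd1 P x t / U x t := by
    unfold bcoef
    field_simp
    linarith
  rw [e]
  exact div_nonneg (by linarith) h0.le

omit H in
/-- Derivative in a parameter of a coefficient of the form `α f + β n / U`. -/
theorem hasDerivAt_coef {f n V : ℝ → ℝ} {f' n' V' s α β : ℝ} (hf : HasDerivAt f f' s)
    (hn : HasDerivAt n n' s) (hV : HasDerivAt V V' s) (hV0 : V s ≠ 0) :
    HasDerivAt (fun s => α * f s + β * n s / V s)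
      (α * f' + β * ((n' * V s - n s * V') / V s ^ 2)) s := by
  refine ((hf.const_mul α).add ((hn.const_mul β).div hV hV0)).congr_deriv ?_
  ring

end BoundedSolution

section VerticalDerivative

theorem abs_le_mul_sq_add_div {s p μ σ : ℝ} (hs : 0 < s) (hσ : 0 < σ) (h : σ ≤ μ * s) :
    |p| ≤ 3 / 2 * s * p ^ 2 + μ / σ := by
  have h1 : 1 / s ≤ μ / σ := by
    rw [div_le_div_iff₀ hs hσ]; linarith
  have h2 : |p| ≤ 3 / 2 * s * p ^ 2 + 1 / s := by
    have e : 3 / 2 * s * p ^ 2 + 1 / s = (3 / 2 * (s * |p|) ^ 2 + 1) / s := by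
      rw [mul_pow, sq_abs]; field_simp
    rw [e, le_div_iff₀ hs]
    nlinarith [sq_nonneg (s * |p| - 1)]
  linarith

theorem nonpos_of_hasDerivAt_of_nonneg {f : ℝ → ℝ} {f' a b : ℝ} (hab : a < b)
    (hf : HasDerivAt f f' b) (h0 : ∀ s ∈ Icc a b, 0 ≤ f s) (hb : f b = 0) : f' ≤ 0 := by
  have h1 : Filter.Tendsto (slope f b) (nhdsWithin b (Iio b)) (nhds f') :=
    (hasDerivWithinAt_iff_tendsto_slope' self_notMem_Iio).1 (hf.hasDerivWithinAt (s := Iio b))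
  refine le_of_tendsto h1 ?_
  filter_upwards [Ioo_mem_nhdsLT hab] with s hs
  rw [slope_def_field, hb, sub_zero]
  exact div_nonpos_of_nonneg_of_nonpos (h0 s ⟨hs.1.le, hs.2.le⟩) (by linarith [hs.2])

/-- Divergence of the flux `(2 A √w, 2 b √w - w √w wᵧ + 2 μ √φ, 2 √w)`. -/
theorem sqrt_flux_le {w s p wx wy wt wyy A Ax b b' c N μ σ v : ℝ} (hs : 0 < s) (hws : w = s ^ 2)
    (hσ : 0 < σ) (hσs : σ ≤ μ * s) (hN : 0 ≤ N) (hv0 : 0 ≤ v) (hv : v ≤ w)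
    (hAx : |Ax| ≤ N) (hb' : |b'| ≤ N) (hc : |c| ≤ N)
    (hpde : wt - w ^ 2 * wyy + A * wx + b * wy + c * v = 0) (hp : p = |wy|) :
    p + (2 * (Ax * s + A * (wx / (2 * s))))
      + (2 * (b' * s + b * (wy / (2 * s)))
        - ((wy * s + w * (wy / (2 * s))) * wy + w * s * wyy) - μ / σ)
      + 2 * (wt / (2 * s)) ≤ 5 * N * s := by
  have h1 := abs_le_mul_sq_add_div (p := wy) hs hσ hσs
  have e : (2 * (Ax * s + A * (wx / (2 * s))))
      + (2 * (b' * s + b * (wy / (2 * s)))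
        - ((wy * s + w * (wy / (2 * s))) * wy + w * s * wyy) - μ / σ)
      + 2 * (wt / (2 * s)) = 2 * Ax * s + 2 * b' * s - 3 / 2 * s * wy ^ 2 - μ / σ
        + (wt - w ^ 2 * wyy + A * wx + b * wy) / s := by
    rw [hws]; field_simp; ring
  have e2 : (wt - w ^ 2 * wyy + A * wx + b * wy) / s ≤ N * s := by
    rw [div_le_iff₀ hs]
    have : -(c * v) ≤ N * w := by
      calc -(c * v) ≤ |c * v| := neg_le_abs _
        _ = |c| * v := by rw [abs_mul, abs_of_nonneg hv0]
        _ ≤ N * w := by gcongr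
    rw [hws] at this
    rw [hws] at hpde ⊢
    linarith
  have e3 : Ax * s ≤ N * s := mul_le_mul_of_nonneg_right ((le_abs_self _).trans hAx) hs.le
  have e4 : b' * s ≤ N * s := mul_le_mul_of_nonneg_right ((le_abs_self _).trans hb') hs.le
  rw [hp]
  linarith

theorem continuousOn_sqrt_flux {X : Type*} [TopologicalSpace X] {Q : Set X}
    {w σ wx wy wt wyy A Ax b b' : X → ℝ} {μ : ℝ}
    (hw : ContinuousOn w Q) (hσ : ContinuousOn σ Q) (hwx : ContinuousOn wx Q)
    (hwy : ContinuousOn wy Q) (hwt : ContinuousOn wt Q) (hwyy : ContinuousOn wyy Q)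
    (hA : ContinuousOn A Q) (hAx : ContinuousOn Ax Q) (hb : ContinuousOn b Q)
    (hb' : ContinuousOn b' Q) (hw0 : ∀ p ∈ Q, 0 < w p) (hσ0 : ∀ p ∈ Q, 0 < σ p) :
    ContinuousOn (fun p => 2 * (Ax p * √(w p) + A p * (wx p / (2 * √(w p))))) Q ∧
    ContinuousOn (fun p => 2 * (b' p * √(w p) + b p * (wy p / (2 * √(w p))))
        - ((wy p * √(w p) + w p * (wy p / (2 * √(w p)))) * wy p + w p * √(w p) * wyy p)
        - μ / √(σ p)) Q ∧
    ContinuousOn (fun p => 2 * (wt p / (2 * √(w p)))) Q := by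
  have h1 : ∀ p ∈ Q, 2 * √(w p) ≠ 0 := fun p hp =>
    mul_ne_zero two_ne_zero (Real.sqrt_ne_zero'.2 (hw0 p hp))
  have h2 : ∀ p ∈ Q, √(σ p) ≠ 0 := fun p hp => Real.sqrt_ne_zero'.2 (hσ0 p hp)
  refine ⟨?_, ?_, ?_⟩ <;> fun_prop (disch := assumption)

end VerticalDerivative

namespace BoundedSolution

variable {L T M ε : ℝ} {U P u₀ u₁ v₀ : ℝ → ℝ → ℝ} {u : ℝ → ℝ → ℝ → ℝ} {x y t : ℝ}
  (H : BoundedSolution L T M ε U P u₀ u₁ v₀ u)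
include H

theorem phi_pos (hy : y ∈ Icc (0:ℝ) 1) : 0 < 1 - y + ε := by linarith [hy.2, H.hε.1]

theorem phi_le (hy : y ∈ Icc (0:ℝ) 1) : 1 - y + ε ≤ 2 := by linarith [hy.1, H.hε.2]

theorem w_le (hx : x ∈ Icc 0 L) (hy : y ∈ Icc (0:ℝ) 1) (ht : t ∈ Icc 0 T) :
    u x y t + ε ≤ 2 * M := by
  have := (H.w_bounds hx hy ht).2
  nlinarith [H.phi_le hy, H.M_pos]

theorem sqrt_w_le (hx : x ∈ Icc 0 L) (hy : y ∈ Icc (0:ℝ) 1) (ht : t ∈ Icc 0 T) :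
    √(u x y t + ε) ≤ 2 * M := by
  rw [Real.sqrt_le_left (by linarith [H.M_pos])]
  nlinarith [H.w_le hx hy ht, H.one_le]

theorem continuousOn_A :
    ContinuousOn (fun p : ℝ × ℝ × ℝ => p.2.1 * U p.1 p.2.2 + ε) (closedCylinder L T) := by
  have h9 : ContinuousOn (fun p : ℝ × ℝ × ℝ => p.2.1) (closedCylinder L T) := by fun_prop
  exact (h9.mul H.euler.1.continuous_xt.continuousOn).add continuousOn_const

theorem continuousOn_A_x :
    ContinuousOn (fun p : ℝ × ℝ × ℝ => p.2.1 * pd1 U p.1 p.2.2) (closedCylinder L T) := by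
  have h9 : ContinuousOn (fun p : ℝ × ℝ × ℝ => p.2.1) (closedCylinder L T) := by fun_prop
  exact h9.mul H.euler.1.pd1.continuous_xt.continuousOn

theorem continuousOn_bcoef_y :
    ContinuousOn (fun p : ℝ × ℝ × ℝ => -2 * p.2.1 * pd1 U p.1 p.2.2 - pd2 U p.1 p.2.2 / U p.1 p.2.2)
      (closedCylinder L T) := by
  have h9 : ContinuousOn (fun p : ℝ × ℝ × ℝ => -2 * p.2.1) (closedCylinder L T) := by fun_prop
  exact (h9.mul H.euler.1.pd1.continuous_xt.continuousOn).sub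
    (H.euler.1.pd2.continuous_xt.continuousOn.div H.euler.1.continuous_xt.continuousOn
      H.continuousOn_U_ne)

theorem boundary_eq (hx : x ∈ Icc 0 L) (ht : t ∈ Icc 0 T) :
    (u x 0 t + ε) * Dy u x 0 t = v₀ x t * (u x 0 t + ε) + pd1 P x t / U x t :=
  H.sol.2.2.2.2.2 x hx t ht

theorem u_top (hx : x ∈ Icc 0 L) (ht : t ∈ Icc 0 T) : u x 1 t = 0 := H.sol.2.2.2.2.1 x hx t ht

theorem Dy_top_nonpos (hx : x ∈ Icc 0 L) (ht : t ∈ Icc 0 T) : Dy u x 1 t ≤ 0 :=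
  nonpos_of_hasDerivAt_of_nonneg zero_lt_one (H.smooth.hasDerivAt_y x 1 t)
    (fun _ hs => H.u_nonneg hx hs ht) (H.u_top hx ht)

set_option maxHeartbeats 1000000 in
theorem integral_abs_Dy_le :
    ∫ p in QT L T, |Dy u p.1 p.2.1 p.2.2|
      ≤ 40 * M ^ 5 * (L * T) + 16 * M ^ 5 * T + 26 * M ^ 5 * (L * T) + 4 * M * L := by
  have hs := H.smooth
  have hM := H.one_le
  have hM0 := H.M_pos
  obtain ⟨c1, c2, c3⟩ := continuousOn_sqrt_flux (Q := closedCylinder L T)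
    (w := fun p => u p.1 p.2.1 p.2.2 + ε) (σ := fun p => 1 - p.2.1 + ε) (μ := √M)
    (hs.add_const ε).continuous.continuousOn (by fun_prop) hs.Dx.continuous.continuousOn
    hs.Dy.continuous.continuousOn hs.Dt.continuous.continuousOn hs.Dy.Dy.continuous.continuousOn
    H.continuousOn_A H.continuousOn_A_x H.continuousOn_bcoef H.continuousOn_bcoef_y
    (fun p hp => H.w_pos hp.1 hp.2.1 hp.2.2) (fun p hp => H.phi_pos hp.2.1)
  have hM5 : M ^ 5 = M ^ 4 * M := by ring
  refine integral_QT_le_of_add_div_le H.hL H.hT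
    (h := fun x y t => |Dy u x y t|)
    (F₁ := fun x y t => 2 * ((y * U x t + ε) * √(u x y t + ε)))
    (F₂ := fun x y t => 2 * (bcoef U x y t * √(u x y t + ε))
      - (u x y t + ε) * √(u x y t + ε) * Dy u x y t + 2 * √M * √(1 - y + ε))
    (F₃ := fun x y t => 2 * √(u x y t + ε))
    (G₁ := fun x y t => 2 * ((y * pd1 U x t) * √(u x y t + ε)
      + (y * U x t + ε) * (Dx u x y t / (2 * √(u x y t + ε)))))
    (G₂ := fun x y t => 2 * ((-2 * y * pd1 U x t - pd2 U x t / U x t) * √(u x y t + ε)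
        + bcoef U x y t * (Dy u x y t / (2 * √(u x y t + ε))))
      - ((Dy u x y t * √(u x y t + ε) + (u x y t + ε) * (Dy u x y t / (2 * √(u x y t + ε))))
          * Dy u x y t + (u x y t + ε) * √(u x y t + ε) * Dy (Dy u) x y t)
      - √M / √(1 - y + ε))
    (G₃ := fun x y t => 2 * (Dt u x y t / (2 * √(u x y t + ε))))
    ?_ ?_ ?_ c1 c2 c3 hs.Dy.continuous.abs.continuousOn ?_ ?_ ?_ ?_
  · intro x hx y hy t ht
    exact (H.hasDerivAt_A_x.mul (((hs.hasDerivAt_x x y t).add_const ε).sqrt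
      (H.w_pos hx hy ht).ne')).const_mul 2
  · intro x hx y hy t ht
    have h1 := (hs.hasDerivAt_y x y t).add_const ε
    have h2 := h1.sqrt (H.w_pos hx hy ht).ne'
    have h3 : HasDerivAt (fun s : ℝ => 1 - s + ε) (-1) y :=
      ((hasDerivAt_id y).const_sub 1).add_const ε
    have h4 := (h3.sqrt (H.phi_pos hy).ne').const_mul (2 * √M)
    refine (((((hasDerivAt_bcoef_y (U := U) (x := x) (t := t)).mul h2).const_mul 2).sub
      ((h1.mul h2).mul (hs.Dy.hasDerivAt_y x y t))).add h4).congr_deriv ?_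
    rw [sub_eq_add_neg _ (√M / √(1 - y + ε))]
    congr 1
    ring
  · intro x hx y hy t ht
    exact (((hs.hasDerivAt_t x y t).add_const ε).sqrt (H.w_pos hx hy ht).ne').const_mul 2
  · intro x hx y hy t ht
    have hx' := Ioo_subset_Icc_self hx
    have hy' := Ioo_subset_Icc_self hy
    have ht' := Ioo_subset_Icc_self ht
    have hw := H.w_pos hx' hy' ht'
    have hσ : √(1 - y + ε) ≤ √M * √(u x y t + ε) := by
      rw [← Real.sqrt_mul hM0.le]
      exact Real.sqrt_le_sqrt (H.w_bounds hx' hy' ht').1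
    have := sqrt_flux_le (N := 4 * M ^ 4) (Real.sqrt_pos.2 hw) (Real.sq_sqrt hw.le).symm
      (Real.sqrt_pos.2 (H.phi_pos hy')) hσ (by positivity) (H.u_nonneg hx' hy' ht')
      (by linarith [H.hε.1]) (H.abs_A_x_le hx' hy' ht') (H.abs_bcoef_y_le hx' hy' ht')
      (H.abs_ccoef_le hx' hy' ht') (H.pde hx' hy' ht') rfl
    refine this.trans ?_
    rw [hM5]
    nlinarith [H.sqrt_w_le hx' hy' ht', pow_pos hM0 4]
  · intro y hy t ht
    have hy' := Ioo_subset_Icc_self hy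
    have ht' := Ioo_subset_Icc_self ht
    have h0 : (0:ℝ) ∈ Icc 0 L := ⟨le_rfl, H.hL.le⟩
    have hLL : L ∈ Icc 0 L := ⟨H.hL.le, le_rfl⟩
    have h1 : (y * U 0 t + ε) * √(u 0 y t + ε) ≤ 4 * M ^ 4 * (2 * M) :=
      mul_le_mul (H.A_le h0 hy' ht') (H.sqrt_w_le h0 hy' ht') (Real.sqrt_nonneg _) (by positivity)
    have h2 := mul_nonneg (H.A_nonneg hLL hy' ht') (Real.sqrt_nonneg (u L y t + ε))
    rw [hM5]
    linarith
  · intro x hx t ht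
    have hx' := Ioo_subset_Icc_self hx
    have ht' := Ioo_subset_Icc_self ht
    have h0 : (0:ℝ) ∈ Icc (0:ℝ) 1 := ⟨le_rfl, zero_le_one⟩
    have h1 : (1:ℝ) ∈ Icc (0:ℝ) 1 := ⟨zero_le_one, le_rfl⟩
    have hb1 : bcoef U x 1 t = 0 := by unfold bcoef; ring
    have k0 : bcoef U x 0 t ≤ 4 * M ^ 4 := by
      have := (le_abs_self _).trans (H.abs_bcoef_le hx' h0 ht')
      linarith
    have k1 : bcoef U x 0 t * √(u x 0 t + ε) ≤ 4 * M ^ 4 * (2 * M) :=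
      mul_le_mul k0 (H.sqrt_w_le hx' h0 ht') (Real.sqrt_nonneg _) (by positivity)
    have k2 : -((u x 0 t + ε) * Dy u x 0 t) ≤ 3 * M ^ 2 := by
      rw [H.boundary_eq hx' ht']
      have a1 := abs_div_le_sq H.M_pos (H.P_bound x hx' t ht').2.1 (H.inv_le_U hx' ht')
      have a2 : |v₀ x t * (u x 0 t + ε)| ≤ M * (2 * M) := by
        rw [abs_mul, abs_of_pos (H.w_pos hx' h0 ht')]
        exact mul_le_mul (H.bound_v x hx' t ht').1 (H.w_le hx' h0 ht') (H.w_pos hx' h0 ht').le hM0.le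
      have a3 := neg_abs_le (v₀ x t * (u x 0 t + ε))
      have a4 := neg_abs_le (pd1 P x t / U x t)
      nlinarith
    have k3 : -((u x 0 t + ε) * √(u x 0 t + ε) * Dy u x 0 t) ≤ 6 * M ^ 3 := by
      calc _ = √(u x 0 t + ε) * -((u x 0 t + ε) * Dy u x 0 t) := by ring
        _ ≤ √(u x 0 t + ε) * (3 * M ^ 2) :=
          mul_le_mul_of_nonneg_left k2 (Real.sqrt_nonneg _)
        _ ≤ 2 * M * (3 * M ^ 2) :=
          mul_le_mul_of_nonneg_right (H.sqrt_w_le hx' h0 ht') (by positivity)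
        _ = _ := by ring
    have k4 : (u x 1 t + ε) * √(u x 1 t + ε) * Dy u x 1 t ≤ 0 :=
      mul_nonpos_of_nonneg_of_nonpos (mul_nonneg (H.w_pos hx' h1 ht').le (Real.sqrt_nonneg _))
        (H.Dy_top_nonpos hx' ht')
    have k5 : √M * √(1 - 0 + ε) ≤ 2 * M := by
      rw [← Real.sqrt_mul hM0.le, Real.sqrt_le_left (by positivity)]
      nlinarith [H.hε.2]
    have k6 : 0 ≤ √M * √(1 - 1 + ε) := by positivity
    have k7 : M ^ 3 ≤ M ^ 4 * M := by
      rw [← hM5]; exact pow_le_pow_right₀ hM (by norm_num)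
    have k8 : M ≤ M ^ 4 * M := by
      rw [← hM5]; exact le_self_pow₀ hM (by norm_num)
    rw [hM5]
    simp only [hb1, zero_mul, mul_zero]
    linarith
  · intro x hx y hy
    have hx' := Ioo_subset_Icc_self hx
    have hy' := Ioo_subset_Icc_self hy
    have h0 : (0:ℝ) ∈ Icc 0 T := ⟨le_rfl, H.hT.le⟩
    have := H.sqrt_w_le hx' hy' h0
    have h2 := Real.sqrt_nonneg (u x y T + ε)
    linarith

end BoundedSolution

section Linearization

theorem hasDerivAt_linearization {ut u uyy A ux b uy c : ℝ → ℝ} {zt z zyy A' zx b' zy c' s ε : ℝ}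
    (hut : HasDerivAt ut zt s) (hu : HasDerivAt u z s) (huyy : HasDerivAt uyy zyy s)
    (hA : HasDerivAt A A' s) (hux : HasDerivAt ux zx s) (hb : HasDerivAt b b' s)
    (huy : HasDerivAt uy zy s) (hc : HasDerivAt c c' s) (hw : u s + ε ≠ 0)
    (h0 : ∀ᶠ σ in nhds s, ut σ - (u σ + ε) ^ 2 * uyy σ + A σ * ux σ + b σ * uy σ + c σ * u σ = 0) :
    zt - (u s + ε) ^ 2 * zyy + A s * zx + b s * zy
      + (c s * (1 - 2 * u s / (u s + ε))
        - 2 * (ut s + A s * ux s + b s * uy s) / (u s + ε)) * z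
      = -(A' * ux s + b' * uy s + c' * u s) := by
  have h1 := (((hut.sub (((hu.add_const ε).fun_pow 2).mul huyy)).add (hA.mul hux)).add
    (hb.mul huy)).add (hc.mul hu)
  have h2 : HasDerivAt (fun σ => ut σ - (u σ + ε) ^ 2 * uyy σ + A σ * ux σ + b σ * uy σ
      + c σ * u σ) 0 s := (hasDerivAt_const s (0:ℝ)).congr_of_eventuallyEq h0
  have h3 := h1.unique h2
  have h4 := h0.self_of_nhds
  have h5 : uyy s = (ut s + A s * ux s + b s * uy s + c s * u s) / (u s + ε) ^ 2 := by
    rw [eq_div_iff (pow_ne_zero 2 hw)]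
    linarith
  rw [h5] at h3
  simp only [Nat.cast_ofNat, Nat.add_one_sub_one, pow_one] at h3
  rw [← sub_eq_zero, ← h3]
  field_simp
  ring

theorem abs_linearization_rhs_le {φ w d v N M A' b' c' q p : ℝ} (hφ : 0 < φ)
    (hdφ : d ≤ φ) (hM : 1 ≤ M) (hφw : φ ≤ M * w) (hN : 0 ≤ N) (hv : 0 ≤ v)
    (hvw : v ≤ w) (hA : |A'| ≤ N) (hb : |b'| ≤ N * d) (hc : |c'| ≤ N) :
    φ * |-(A' * q + b' * p + c' * v)| ≤ N * φ * |q| + w ^ 2 * (N * M ^ 2 * (1 + |p|)) := by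
  have hw : 0 ≤ w := hv.trans hvw
  have h1 : |-(A' * q + b' * p + c' * v)| ≤ N * |q| + N * φ * |p| + N * w := by
    rw [abs_neg]
    calc _ ≤ |A' * q| + |b' * p| + |c' * v| := abs_add_three _ _ _
      _ = |A'| * |q| + |b'| * |p| + |c'| * v := by
        rw [abs_mul, abs_mul, abs_mul, abs_of_nonneg hv]
      _ ≤ _ := by
        have : |b'| ≤ N * φ := hb.trans (mul_le_mul_of_nonneg_left hdφ hN)
        gcongr
  have h2 : φ * φ ≤ M ^ 2 * w ^ 2 := by
    calc φ * φ ≤ (M * w) * (M * w) := mul_le_mul hφw hφw hφ.le (by positivity)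
      _ = _ := by ring
  have h3 : φ * w ≤ M ^ 2 * w ^ 2 := by
    calc φ * w ≤ M * w * w := mul_le_mul_of_nonneg_right hφw hw
      _ = M * w ^ 2 := by ring
      _ ≤ M ^ 2 * w ^ 2 := by gcongr; nlinarith
  calc _ ≤ φ * (N * |q| + N * φ * |p| + N * w) := mul_le_mul_of_nonneg_left h1 hφ.le
    _ = N * φ * |q| + (N * |p| * (φ * φ) + N * (φ * w)) := by ring
    _ ≤ N * φ * |q| + (N * |p| * (M ^ 2 * w ^ 2) + N * (M ^ 2 * w ^ 2)) := by gcongr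
    _ = _ := by ring

end Linearization

theorem Dx_add_const (u : ℝ → ℝ → ℝ → ℝ) (r x y t : ℝ) :
    Dx (fun x y t => u x y t + r) x y t = Dx u x y t := deriv_add_const _

theorem Dy_add_const (u : ℝ → ℝ → ℝ → ℝ) (r x y t : ℝ) :
    Dy (fun x y t => u x y t + r) x y t = Dy u x y t := deriv_add_const _

theorem Dt_add_const (u : ℝ → ℝ → ℝ → ℝ) (r x y t : ℝ) :
    Dt (fun x y t => u x y t + r) x y t = Dt u x y t := deriv_add_const _

namespace BoundedSolution

variable {L T M ε : ℝ} {U P u₀ u₁ v₀ : ℝ → ℝ → ℝ} {u : ℝ → ℝ → ℝ → ℝ} {x y t : ℝ}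

theorem abs_coef_le {f' q d : ℝ} (hM : 1 ≤ M) (hy : y ∈ Icc (0:ℝ) 1) (hf : |f'| ≤ M)
    (hq : |q| ≤ M ^ 2 + M ^ 4) (hd : d = 1 - y) :
    |(1 - y ^ 2) * f' + (1 - y) * q| ≤ 4 * M ^ 4 * d ∧ |(1 - y) * f' + -1 * q| ≤ 4 * M ^ 4 := by
  have hM1 : M ≤ M ^ 4 := le_self_pow₀ hM (by norm_num)
  have hM2 : M ^ 2 ≤ M ^ 4 := pow_le_pow_right₀ hM (by norm_num)
  have hM0 : 0 < M := by linarith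
  have hd0 : 0 ≤ 1 - y := by linarith [hy.2]
  have hd1 : 1 - y ≤ 1 := by linarith [hy.1]
  constructor
  · have e : (1 - y ^ 2) * f' + (1 - y) * q = (1 - y) * ((1 + y) * f' + q) := by ring
    have h1 : |(1 + y) * f'| ≤ 2 * M := by
      rw [abs_mul, abs_of_nonneg (by linarith [hy.1])]
      exact mul_le_mul (by linarith [hy.2]) hf (abs_nonneg _) (by norm_num)
    rw [e, hd, abs_mul, abs_of_nonneg hd0, mul_comm]
    refine mul_le_mul_of_nonneg_right ?_ hd0
    linarith [abs_add_le ((1 + y) * f') q]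
  · have h1 : |(1 - y) * f'| ≤ 1 * M := by
      rw [abs_mul, abs_of_nonneg hd0]
      exact mul_le_mul hd1 hf (abs_nonneg _) (by norm_num)
    have h2 := abs_add_le ((1 - y) * f') (-1 * q)
    rw [abs_mul (-1), abs_neg, abs_one, one_mul] at h2
    linarith

variable (H : BoundedSolution L T M ε U P u₀ u₁ v₀ u)
include H

/-- The right-hand side estimate for the equation satisfied by the derivative of `u` along one of
the directions `x`, `t`; the hypotheses list the derivatives along that direction at a point. -/
theorem linearized_le {X τ : ℝ → ℝ} {s z zt zx zy zyy f' n' V' m' : ℝ}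
    (hX : X s ∈ Ioo 0 L) (hτ : τ s ∈ Ioo 0 T) (hy : y ∈ Ioo (0:ℝ) 1)
    (hXc : ContinuousAt X s) (hτc : ContinuousAt τ s)
    (hu : HasDerivAt (fun σ => u (X σ) y (τ σ)) z s)
    (hut : HasDerivAt (fun σ => Dt u (X σ) y (τ σ)) zt s)
    (hux : HasDerivAt (fun σ => Dx u (X σ) y (τ σ)) zx s)
    (huy : HasDerivAt (fun σ => Dy u (X σ) y (τ σ)) zy s)
    (huyy : HasDerivAt (fun σ => Dy (Dy u) (X σ) y (τ σ)) zyy s)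
    (hf : HasDerivAt (fun σ => pd1 U (X σ) (τ σ)) f' s) (hf' : |f'| ≤ M)
    (hn : HasDerivAt (fun σ => pd2 U (X σ) (τ σ)) n' s) (hn' : |n'| ≤ M)
    (hV : HasDerivAt (fun σ => U (X σ) (τ σ)) V' s) (hV' : |V'| ≤ M)
    (hm : HasDerivAt (fun σ => pd1 P (X σ) (τ σ)) m' s) (hm' : |m'| ≤ M) :
    (1 - y + ε) * |zt - (u (X s) y (τ s) + ε) ^ 2 * zyy + (y * U (X s) (τ s) + ε) * zx
      + bcoef U (X s) y (τ s) * zy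
      + (ccoef U P (X s) y (τ s) * (1 - 2 * u (X s) y (τ s) / (u (X s) y (τ s) + ε))
        - 2 * (Dt u (X s) y (τ s) + (y * U (X s) (τ s) + ε) * Dx u (X s) y (τ s)
          + bcoef U (X s) y (τ s) * Dy u (X s) y (τ s)) / (u (X s) y (τ s) + ε)) * z|
    ≤ 4 * M ^ 4 * (1 - y + ε) * |Dx u (X s) y (τ s)|
      + (u (X s) y (τ s) + ε) ^ 2 * (4 * M ^ 4 * M ^ 2 * (1 + |Dy u (X s) y (τ s)|)) := by
  have hX' := Ioo_subset_Icc_self hX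
  have hτ' := Ioo_subset_Icc_self hτ
  have hy' := Ioo_subset_Icc_self hy
  have hM := H.M_pos
  have hV0 := (H.U_pos hX' hτ').ne'
  have hUM := H.inv_le_U hX' hτ'
  have hev : ∀ᶠ σ in nhds s, Dt u (X σ) y (τ σ)
      - (u (X σ) y (τ σ) + ε) ^ 2 * Dy (Dy u) (X σ) y (τ σ)
      + (y * U (X σ) (τ σ) + ε) * Dx u (X σ) y (τ σ)
      + bcoef U (X σ) y (τ σ) * Dy u (X σ) y (τ σ)
      + ccoef U P (X σ) y (τ σ) * u (X σ) y (τ σ) = 0 := by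
    filter_upwards [hXc.eventually_mem (Ioo_mem_nhds hX.1 hX.2),
      hτc.eventually_mem (Ioo_mem_nhds hτ.1 hτ.2)] with σ h1 h2
    exact H.pde (Ioo_subset_Icc_self h1) hy' (Ioo_subset_Icc_self h2)
  have hb : HasDerivAt (fun σ => bcoef U (X σ) y (τ σ)) _ s :=
    hasDerivAt_coef (α := 1 - y ^ 2) (β := 1 - y) hf hn hV hV0
  have hc : HasDerivAt (fun σ => ccoef U P (X σ) y (τ σ)) _ s :=
    (hasDerivAt_coef (α := 1 - y) (β := -1) hf hm hV hV0).congr_of_eventuallyEq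
      (Filter.Eventually.of_forall fun σ => by simp only [ccoef]; ring)
  have hA := (hV.const_mul y).add_const ε
  rw [hasDerivAt_linearization hut hu huyy hA hux hb huy hc (H.w_pos hX' hy' hτ').ne' hev]
  have q1 := abs_deriv_quotient_le hM (H.abs_Ut_le hX' hτ') hn' hUM hV'
  have q2 := abs_deriv_quotient_le hM (H.P_bound _ hX' _ hτ').2.1 hm' hUM hV'
  refine abs_linearization_rhs_le (d := 1 - y) (H.phi_pos hy')
    (by linarith [H.hε.1]) H.one_le (H.w_bounds hX' hy' hτ').1 (by positivity)
    (H.u_nonneg hX' hy' hτ') (by linarith [H.hε.1]) ?_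
    (abs_coef_le H.one_le hy' hf' q1 rfl).1 (abs_coef_le H.one_le hy' hf' q2 rfl).2
  have := abs_mul_le_of_mem hy' hV'
  linarith [H.le_pow.1]

theorem linearized_x_le (hx : x ∈ Ioo 0 L) (hy : y ∈ Ioo (0:ℝ) 1) (ht : t ∈ Ioo 0 T) :
    (1 - y + ε) * |Dt (Dx u) x y t - (u x y t + ε) ^ 2 * Dy (Dy (Dx u)) x y t
      + (y * U x t + ε) * Dx (Dx u) x y t + bcoef U x y t * Dy (Dx u) x y t
      + (ccoef U P x y t * (1 - 2 * u x y t / (u x y t + ε))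
        - 2 * (Dt u x y t + (y * U x t + ε) * Dx u x y t
          + bcoef U x y t * Dy u x y t) / (u x y t + ε)) * Dx u x y t|
    ≤ 4 * M ^ 4 * (1 - y + ε) * |Dx u x y t|
      + (u x y t + ε) ^ 2 * (4 * M ^ 4 * M ^ 2 * (1 + |Dy u x y t|)) := by
  have hs := H.smooth
  have hU := H.euler.1
  have hx' := Ioo_subset_Icc_self hx
  have ht' := Ioo_subset_Icc_self ht
  have hUb := (H.U_bound x hx' t ht').2.2.2
  have e1 : Dx (Dy u) = Dy (Dx u) := by
    funext x y t; exact hs.Dx_Dy x y t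
  have := H.linearized_le (X := fun σ => σ) (τ := fun _ => t) (s := x) (y := y)
    hx ht hy continuousAt_id continuousAt_const
    (hs.hasDerivAt_x x y t) (hs.Dt.hasDerivAt_x x y t) (hs.Dx.hasDerivAt_x x y t)
    (hs.Dy.hasDerivAt_x x y t) (hs.Dy.Dy.hasDerivAt_x x y t)
    (hU.pd1.hasDerivAt_fst x t) hUb.1 (hU.pd2.hasDerivAt_fst x t)
    (by rw [hU.pd1_pd2]; exact hUb.2.2) (hU.hasDerivAt_fst x t) (H.abs_Ux_le hx' ht')
    (H.euler.2.1.pd1.hasDerivAt_fst x t) (H.P_bound x hx' t ht').2.2.2.1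
  rwa [hs.Dx_Dt, hs.Dy.Dx_Dy, e1] at this

theorem linearized_t_le (hx : x ∈ Ioo 0 L) (hy : y ∈ Ioo (0:ℝ) 1) (ht : t ∈ Ioo 0 T) :
    (1 - y + ε) * |Dt (Dt u) x y t - (u x y t + ε) ^ 2 * Dy (Dy (Dt u)) x y t
      + (y * U x t + ε) * Dx (Dt u) x y t + bcoef U x y t * Dy (Dt u) x y t
      + (ccoef U P x y t * (1 - 2 * u x y t / (u x y t + ε))
        - 2 * (Dt u x y t + (y * U x t + ε) * Dx u x y t
          + bcoef U x y t * Dy u x y t) / (u x y t + ε)) * Dt u x y t|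
    ≤ 4 * M ^ 4 * (1 - y + ε) * |Dx u x y t|
      + (u x y t + ε) ^ 2 * (4 * M ^ 4 * M ^ 2 * (1 + |Dy u x y t|)) := by
  have hs := H.smooth
  have hU := H.euler.1
  have hx' := Ioo_subset_Icc_self hx
  have ht' := Ioo_subset_Icc_self ht
  have hUb := (H.U_bound x hx' t ht').2.2.2
  have e1 : Dt (Dy u) = Dy (Dt u) := by
    funext x y t; exact hs.Dt_Dy x y t
  have := H.linearized_le (X := fun _ => x) (τ := fun σ => σ) (s := t) (y := y)
    hx ht hy continuousAt_const continuousAt_id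
    (hs.hasDerivAt_t x y t) (hs.Dt.hasDerivAt_t x y t) (hs.Dx.hasDerivAt_t x y t)
    (hs.Dy.hasDerivAt_t x y t) (hs.Dy.Dy.hasDerivAt_t x y t)
    (hU.pd1.hasDerivAt_snd x t) hUb.2.2 (hU.pd2.hasDerivAt_snd x t) hUb.2.1
    (hU.hasDerivAt_snd x t) (H.abs_Ut_le hx' ht')
    (H.euler.2.1.pd1.hasDerivAt_snd x t) (H.P_bound x hx' t ht').2.2.2.2.2
  rwa [← hs.Dx_Dt, hs.Dy.Dt_Dy, e1] at this

end BoundedSolution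

section BoundaryData

theorem abs_le_mul_one_sub {f f' : ℝ → ℝ} {K y : ℝ} (hy : y ∈ Icc (0:ℝ) 1)
    (hf : ∀ s, HasDerivAt f (f' s) s) (hf' : ∀ s ∈ Icc (0:ℝ) 1, |f' s| ≤ K) (h1 : f 1 = 0) :
    |f y| ≤ K * (1 - y) := by
  have h := (convex_Icc (0:ℝ) 1).norm_image_sub_le_of_norm_hasDerivWithin_le
    (fun s _ => (hf s).hasDerivWithinAt) hf' ⟨zero_le_one, le_rfl⟩ hy
  rw [h1, sub_zero, Real.norm_eq_abs, Real.norm_eq_abs, abs_sub_comm,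
    abs_of_nonneg (by linarith [hy.2] : (0:ℝ) ≤ 1 - y)] at h
  exact h

theorem mul_div_sq_le {φ w X M K₁ K₂ : ℝ} (hφ : 0 < φ) (hφ2 : φ ≤ 2) (hw : 0 < w)
    (hφw : φ ≤ M * w) (hK₁ : 0 ≤ K₁) (hK₂ : 0 ≤ K₂) (hX : X ≤ K₁ * φ + K₂ * w ^ 2) :
    φ * X / w ^ 2 ≤ K₁ * M ^ 2 + 2 * K₂ := by
  rw [div_le_iff₀ (by positivity)]
  have h2 : φ * φ ≤ (M * w) * (M * w) :=
    mul_le_mul hφw hφw hφ.le (hφ.le.trans hφw)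
  calc φ * X ≤ φ * (K₁ * φ + K₂ * w ^ 2) := mul_le_mul_of_nonneg_left hX hφ.le
    _ = K₁ * (φ * φ) + K₂ * w ^ 2 * φ := by ring
    _ ≤ K₁ * ((M * w) * (M * w)) + K₂ * w ^ 2 * 2 := by gcongr
    _ = _ := by ring

end BoundaryData

namespace BoundedSolution

variable {L T M ε : ℝ} {U P u₀ u₁ v₀ : ℝ → ℝ → ℝ} {u : ℝ → ℝ → ℝ → ℝ} {x y t : ℝ}
  (H : BoundedSolution L T M ε U P u₀ u₁ v₀ u)
include H

theorem initial_eq (hx : x ∈ Icc 0 L) (hy : y ∈ Icc (0:ℝ) 1) : u x y 0 = u₀ x y :=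
  H.sol.2.2.1 x hx y hy

theorem left_eq (hy : y ∈ Icc (0:ℝ) 1) (ht : t ∈ Icc 0 T) : u 0 y t = u₁ y t :=
  H.sol.2.2.2.1 y hy t ht

theorem Dx_initial (hx : x ∈ Ioo 0 L) (hy : y ∈ Icc (0:ℝ) 1) : Dx u x y 0 = pd1 u₀ x y := by
  refine Filter.EventuallyEq.deriv_eq ?_
  filter_upwards [Ioo_mem_nhds hx.1 hx.2] with s hs
  exact H.initial_eq (Ioo_subset_Icc_self hs) hy

theorem Dy_initial (hx : x ∈ Icc 0 L) (hy : y ∈ Ioo (0:ℝ) 1) : Dy u x y 0 = pd2 u₀ x y := by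
  refine Filter.EventuallyEq.deriv_eq ?_
  filter_upwards [Ioo_mem_nhds hy.1 hy.2] with s hs
  exact H.initial_eq hx (Ioo_subset_Icc_self hs)

theorem Dy_Dy_initial (hx : x ∈ Icc 0 L) (hy : y ∈ Ioo (0:ℝ) 1) :
    Dy (Dy u) x y 0 = pd2 (pd2 u₀) x y := by
  refine Filter.EventuallyEq.deriv_eq ?_
  filter_upwards [Ioo_mem_nhds hy.1 hy.2] with s hs
  exact H.Dy_initial hx hs

theorem Dt_left (hy : y ∈ Icc (0:ℝ) 1) (ht : t ∈ Ioo 0 T) : Dt u 0 y t = pd2 u₁ y t := by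
  refine Filter.EventuallyEq.deriv_eq ?_
  filter_upwards [Ioo_mem_nhds ht.1 ht.2] with s hs
  exact H.left_eq hy (Ioo_subset_Icc_self hs)

theorem Dy_left (hy : y ∈ Ioo (0:ℝ) 1) (ht : t ∈ Icc 0 T) : Dy u 0 y t = pd1 u₁ y t := by
  refine Filter.EventuallyEq.deriv_eq ?_
  filter_upwards [Ioo_mem_nhds hy.1 hy.2] with s hs
  exact H.left_eq (Ioo_subset_Icc_self hs) ht

theorem Dy_Dy_left (hy : y ∈ Ioo (0:ℝ) 1) (ht : t ∈ Icc 0 T) :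
    Dy (Dy u) 0 y t = pd1 (pd1 u₁) y t := by
  refine Filter.EventuallyEq.deriv_eq ?_
  filter_upwards [Ioo_mem_nhds hy.1 hy.2] with s hs
  exact H.Dy_left hs ht

theorem Dx_top (hx : x ∈ Ioo 0 L) (ht : t ∈ Icc 0 T) : Dx u x 1 t = 0 := by
  have : Dx u x 1 t = deriv (fun _ => (0:ℝ)) x := by
    refine Filter.EventuallyEq.deriv_eq ?_
    filter_upwards [Ioo_mem_nhds hx.1 hx.2] with s hs
    exact H.u_top (Ioo_subset_Icc_self hs) ht
  rw [this, deriv_const]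

theorem Dt_top (hx : x ∈ Icc 0 L) (ht : t ∈ Ioo 0 T) : Dt u x 1 t = 0 := by
  have : Dt u x 1 t = deriv (fun _ => (0:ℝ)) t := by
    refine Filter.EventuallyEq.deriv_eq ?_
    filter_upwards [Ioo_mem_nhds ht.1 ht.2] with s hs
    exact H.u_top hx (Ioo_subset_Icc_self hs)
  rw [this, deriv_const]

theorem abs_Dx_initial_le (hx : x ∈ Ioo 0 L) (hy : y ∈ Icc (0:ℝ) 1) :
    |Dx u x y 0| ≤ M * (1 - y) := by
  have hx' := Ioo_subset_Icc_self hx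
  have h0 : (0:ℝ) ∈ Icc 0 T := ⟨le_rfl, H.hT.le⟩
  have h1 : (1:ℝ) ∈ Icc (0:ℝ) 1 := ⟨zero_le_one, le_rfl⟩
  rw [H.Dx_initial hx hy]
  refine abs_le_mul_one_sub hy (fun s => H.smooth₀.pd1.hasDerivAt_snd x s)
    (fun s hs => (H.bound₀ x hx' s hs).2.2.2.2.2) ?_
  rw [← H.Dx_initial hx h1, H.Dx_top hx h0]

theorem abs_Dt_left_le (hy : y ∈ Icc (0:ℝ) 1) (ht : t ∈ Ioo 0 T) :
    |Dt u 0 y t| ≤ M * (1 - y) := by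
  have ht' := Ioo_subset_Icc_self ht
  have h0 : (0:ℝ) ∈ Icc 0 L := ⟨le_rfl, H.hL.le⟩
  have h1 : (1:ℝ) ∈ Icc (0:ℝ) 1 := ⟨zero_le_one, le_rfl⟩
  rw [H.Dt_left hy ht]
  refine abs_le_mul_one_sub hy (fun s => H.smooth₁.pd2.hasDerivAt_fst s t)
    (fun s hs => ?_) ?_
  · rw [H.smooth₁.pd1_pd2]
    exact (H.bound₁ s hs t ht').2.2.2.2.2
  · rw [← H.Dt_left h1 ht, H.Dt_top h0 ht]

/-- The lower order terms of the equation, on faces where `∂ᵧu` is controlled. -/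
theorem abs_lower_order_le (hx : x ∈ Icc 0 L) (hy : y ∈ Icc (0:ℝ) 1) (ht : t ∈ Icc 0 T)
    (h1 : |Dy u x y t| ≤ M) (h2 : |Dy (Dy u) x y t| ≤ M) :
    |(u x y t + ε) ^ 2 * Dy (Dy u) x y t - bcoef U x y t * Dy u x y t
      - ccoef U P x y t * u x y t|
      ≤ 8 * M ^ 5 * (1 - y + ε) + M * (u x y t + ε) ^ 2 := by
  have hM := H.M_pos
  have hy0 : 0 ≤ 1 - y := by linarith [hy.2]
  have a1 : |(u x y t + ε) ^ 2 * Dy (Dy u) x y t| ≤ M * (u x y t + ε) ^ 2 := by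
    rw [abs_mul, abs_of_nonneg (sq_nonneg (u x y t + ε)), mul_comm]
    gcongr
  have a2 : |bcoef U x y t * Dy u x y t| ≤ 4 * M ^ 4 * (1 - y) * M := by
    rw [abs_mul]
    exact mul_le_mul (H.abs_bcoef_le hx hy ht) h1 (abs_nonneg _) (by positivity)
  have a3 : |ccoef U P x y t * u x y t| ≤ 4 * M ^ 4 * (M * (1 - y)) := by
    rw [abs_mul, abs_of_nonneg (H.u_nonneg hx hy ht)]
    exact mul_le_mul (H.abs_ccoef_le hx hy ht) (H.bounds_closed hx hy ht).2
      (H.u_nonneg hx hy ht) (by positivity)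
  have a4 := abs_sub ((u x y t + ε) ^ 2 * Dy (Dy u) x y t - bcoef U x y t * Dy u x y t)
    (ccoef U P x y t * u x y t)
  have a5 := abs_sub ((u x y t + ε) ^ 2 * Dy (Dy u) x y t) (bcoef U x y t * Dy u x y t)
  have a6 : 0 ≤ M ^ 5 * ε := mul_nonneg (by positivity) H.hε.1.le
  nlinarith

theorem weight_le {K₁ K₂ X : ℝ} (hx : x ∈ Icc 0 L) (hy : y ∈ Icc (0:ℝ) 1) (ht : t ∈ Icc 0 T)
    (hK₁ : 0 ≤ K₁) (hK₁' : K₁ ≤ 12 * M ^ 5) (hK₂ : 0 ≤ K₂) (hK₂' : K₂ ≤ M)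
    (hX : X ≤ K₁ * (1 - y + ε) + K₂ * (u x y t + ε) ^ 2) :
    (1 - y + ε) * X / (u x y t + ε) ^ 2 ≤ 14 * M ^ 7 := by
  have h := mul_div_sq_le (H.phi_pos hy) (H.phi_le hy) (H.w_pos hx hy ht) (H.w_bounds hx hy ht).1
    hK₁ hK₂ hX
  have h1 : K₁ * M ^ 2 ≤ 12 * M ^ 5 * M ^ 2 := by gcongr
  have h2 : M ≤ M ^ 7 := le_self_pow₀ H.one_le (by norm_num)
  calc _ ≤ K₁ * M ^ 2 + 2 * K₂ := h
    _ ≤ 12 * M ^ 5 * M ^ 2 + 2 * M ^ 7 := by linarith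
    _ = _ := by ring

theorem one_sub_le_phi {K : ℝ} (hK : 0 ≤ K) : K * (1 - y) ≤ K * (1 - y + ε) :=
  mul_le_mul_of_nonneg_left (by linarith [H.hε.1]) hK

theorem M_le_pow_five : M ≤ M ^ 5 := le_self_pow₀ H.one_le (by norm_num)

theorem weight_Dx_initial (hx : x ∈ Ioo 0 L) (hy : y ∈ Ioo (0:ℝ) 1) :
    (1 - y + ε) * |Dx u x y 0| / (u x y 0 + ε) ^ 2 ≤ 14 * M ^ 7 := by
  have hx' := Ioo_subset_Icc_self hx
  have hy' := Ioo_subset_Icc_self hy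
  have hM := H.M_pos
  refine H.weight_le (K₁ := M) (K₂ := 0) hx' hy' ⟨le_rfl, H.hT.le⟩ hM.le
    (by linarith [H.M_le_pow_five]) le_rfl hM.le ?_
  linarith [H.abs_Dx_initial_le hx hy', H.one_sub_le_phi (y := y) hM.le]

theorem weight_Dt_initial (hx : x ∈ Ioo 0 L) (hy : y ∈ Ioo (0:ℝ) 1) :
    (1 - y + ε) * |Dt u x y 0| / (u x y 0 + ε) ^ 2 ≤ 14 * M ^ 7 := by
  have hx' := Ioo_subset_Icc_self hx
  have hy' := Ioo_subset_Icc_self hy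
  have h0 : (0:ℝ) ∈ Icc 0 T := ⟨le_rfl, H.hT.le⟩
  have hM := H.M_pos
  have hb := H.bound₀ x hx' y hy'
  refine H.weight_le (K₁ := 12 * M ^ 5) (K₂ := M) hx' hy' h0 (by positivity) le_rfl hM.le le_rfl ?_
  have h1 := H.abs_lower_order_le hx' hy' h0 (by rw [H.Dy_initial hx' hy]; exact hb.2.2.1)
    (by rw [H.Dy_Dy_initial hx' hy]; exact hb.2.2.2.2.1)
  have h2 : |(y * U x 0 + ε) * Dx u x y 0| ≤ 4 * M ^ 4 * (M * (1 - y)) := by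
    rw [abs_mul, abs_of_nonneg (H.A_nonneg hx' hy' h0)]
    exact mul_le_mul (H.A_le hx' hy' h0) (H.abs_Dx_initial_le hx hy') (abs_nonneg _)
      (by positivity)
  have e : Dt u x y 0 = ((u x y 0 + ε) ^ 2 * Dy (Dy u) x y 0 - bcoef U x y 0 * Dy u x y 0
      - ccoef U P x y 0 * u x y 0) - (y * U x 0 + ε) * Dx u x y 0 := by
    linarith [H.pde hx' hy' h0]
  rw [e]
  refine (abs_sub _ _).trans ?_
  have h3 := H.one_sub_le_phi (y := y) (K := 4 * M ^ 5) (by positivity)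
  linarith

theorem weight_Dt_left (hy : y ∈ Ioo (0:ℝ) 1) (ht : t ∈ Ioo 0 T) :
    (y * U 0 t + ε) * (1 - y + ε) * |Dt u 0 y t| / (u 0 y t + ε) ^ 2 ≤ 14 * M ^ 7 := by
  have ht' := Ioo_subset_Icc_self ht
  have hy' := Ioo_subset_Icc_self hy
  have h0 : (0:ℝ) ∈ Icc 0 L := ⟨le_rfl, H.hL.le⟩
  have hM := H.M_pos
  have e : (y * U 0 t + ε) * (1 - y + ε) * |Dt u 0 y t|
      = (1 - y + ε) * ((y * U 0 t + ε) * |Dt u 0 y t|) := by ring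
  rw [e]
  refine H.weight_le (K₁ := 4 * M ^ 5) (K₂ := 0) h0 hy' ht' (by positivity)
    (by linarith [pow_pos hM 5]) le_rfl hM.le ?_
  have h2 : (y * U 0 t + ε) * |Dt u 0 y t| ≤ 4 * M ^ 4 * (M * (1 - y)) :=
    mul_le_mul (H.A_le h0 hy' ht') (H.abs_Dt_left_le hy' ht) (abs_nonneg _) (by positivity)
  have h3 := H.one_sub_le_phi (y := y) (K := 4 * M ^ 5) (by positivity)
  linarith

theorem weight_Dx_left (hy : y ∈ Ioo (0:ℝ) 1) (ht : t ∈ Ioo 0 T) :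
    (y * U 0 t + ε) * (1 - y + ε) * |Dx u 0 y t| / (u 0 y t + ε) ^ 2 ≤ 14 * M ^ 7 := by
  have ht' := Ioo_subset_Icc_self ht
  have hy' := Ioo_subset_Icc_self hy
  have h0 : (0:ℝ) ∈ Icc 0 L := ⟨le_rfl, H.hL.le⟩
  have hM := H.M_pos
  have hb := H.bound₁ y hy' t ht'
  have e : (y * U 0 t + ε) * (1 - y + ε) * |Dx u 0 y t|
      = (1 - y + ε) * |(y * U 0 t + ε) * Dx u 0 y t| := by
    rw [abs_mul, abs_of_nonneg (H.A_nonneg h0 hy' ht')]; ring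
  rw [e]
  refine H.weight_le (K₁ := 12 * M ^ 5) (K₂ := M) h0 hy' ht' (by positivity) le_rfl hM.le le_rfl ?_
  have h1 := H.abs_lower_order_le h0 hy' ht' (by rw [H.Dy_left hy ht']; exact hb.2.1)
    (by rw [H.Dy_Dy_left hy ht']; exact hb.2.2.2.1)
  have e2 : (y * U 0 t + ε) * Dx u 0 y t = ((u 0 y t + ε) ^ 2 * Dy (Dy u) 0 y t
      - bcoef U 0 y t * Dy u 0 y t - ccoef U P 0 y t * u 0 y t) - Dt u 0 y t := by
    linarith [H.pde h0 hy' ht']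
  rw [e2]
  refine (abs_sub _ _).trans ?_
  have h2 := H.abs_Dt_left_le hy' ht
  have h3 := H.one_sub_le_phi (y := y) hM.le
  have h4 := mul_le_mul_of_nonneg_right H.M_le_pow_five (H.phi_pos hy').le
  have h5 : 0 ≤ M ^ 5 * (1 - y + ε) := mul_nonneg (by positivity) (H.phi_pos hy').le
  linarith

/-- The derivative of the nonlinear boundary condition on `{y = 0}` along the boundary. -/
theorem abs_boundary_deriv_le {X τ : ℝ → ℝ} {s z zy v' m' V' : ℝ}
    (hX : X s ∈ Ioo 0 L) (hτ : τ s ∈ Ioo 0 T)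
    (hXc : ContinuousAt X s) (hτc : ContinuousAt τ s)
    (hu : HasDerivAt (fun σ => u (X σ) 0 (τ σ)) z s)
    (huy : HasDerivAt (fun σ => Dy u (X σ) 0 (τ σ)) zy s)
    (hv : HasDerivAt (fun σ => v₀ (X σ) (τ σ)) v' s) (hv' : |v'| ≤ M)
    (hm : HasDerivAt (fun σ => pd1 P (X σ) (τ σ)) m' s) (hm' : |m'| ≤ M)
    (hV : HasDerivAt (fun σ => U (X σ) (τ σ)) V' s) (hV' : |V'| ≤ M) :
    |zy - bcoef U (X s) 0 (τ s) * z / (u (X s) 0 (τ s) + ε) ^ 2| ≤ 14 * M ^ 7 := by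
  have hX' := Ioo_subset_Icc_self hX
  have hτ' := Ioo_subset_Icc_self hτ
  have h0 : (0:ℝ) ∈ Icc (0:ℝ) 1 := ⟨le_rfl, zero_le_one⟩
  have hM := H.M_pos
  have hV0 := (H.U_pos hX' hτ').ne'
  have hw := H.w_pos hX' h0 hτ'
  have hev : ∀ᶠ σ in nhds s, (u (X σ) 0 (τ σ) + ε) * Dy u (X σ) 0 (τ σ)
      = v₀ (X σ) (τ σ) * (u (X σ) 0 (τ σ) + ε) + pd1 P (X σ) (τ σ) / U (X σ) (τ σ) := by
    filter_upwards [hXc.eventually_mem (Ioo_mem_nhds hX.1 hX.2),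
      hτc.eventually_mem (Ioo_mem_nhds hτ.1 hτ.2)] with σ h1 h2
    exact H.boundary_eq (Ioo_subset_Icc_self h1) (Ioo_subset_Icc_self h2)
  have hl := (hu.add_const ε).mul huy
  have hr := (hv.mul (hu.add_const ε)).add (hm.div hV hV0)
  have heq := hl.unique (hr.congr_of_eventuallyEq hev)
  have hq := abs_deriv_quotient_le hM (H.P_bound _ hX' _ hτ').2.1 hm' (H.inv_le_U hX' hτ') hV'
  have hbe := H.boundary_eq hX' hτ'
  have hb : bcoef U (X s) 0 (τ s) = -(pd1 P (X s) (τ s) / U (X s) (τ s)) := by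
    have := H.euler.2.2.2.1 _ hX' _ hτ'
    unfold bcoef
    field_simp
    linarith
  generalize (m' * U (X s) (τ s) - pd1 P (X s) (τ s) * V') / U (X s) (τ s) ^ 2 = g' at *
  have hw1 := (H.w_bounds hX' h0 hτ').1
  rw [hb]
  generalize pd1 P (X s) (τ s) / U (X s) (τ s) = g at *
  generalize u (X s) 0 (τ s) + ε = w at *
  have e : zy - -g * z / w ^ 2 = v' + g' / w := by
    have hg : g = w * Dy u (X s) 0 (τ s) - v₀ (X s) (τ s) * w := by linarith
    rw [hg]
    field_simp
    linarith
  rw [e]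
  have h1 : |g' / w| ≤ (M ^ 2 + M ^ 4) * M := by
    rw [abs_div, abs_of_pos hw, div_le_iff₀ hw]
    have : 1 ≤ M * w := by linarith [H.hε.1]
    calc |g'| ≤ (M ^ 2 + M ^ 4) * 1 := by linarith
      _ ≤ (M ^ 2 + M ^ 4) * (M * w) := by gcongr
      _ = _ := by ring
  have p1 : M ≤ M ^ 7 := le_self_pow₀ H.one_le (by norm_num)
  have p2 : M ^ 3 ≤ M ^ 7 := pow_le_pow_right₀ H.one_le (by norm_num)
  have p3 : M ^ 5 ≤ M ^ 7 := pow_le_pow_right₀ H.one_le (by norm_num)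
  have := abs_add_le v' (g' / w)
  nlinarith [pow_pos hM 7]

theorem boundary_Dx_le (hx : x ∈ Ioo 0 L) (ht : t ∈ Ioo 0 T) :
    |Dy (Dx u) x 0 t - bcoef U x 0 t * Dx u x 0 t / (u x 0 t + ε) ^ 2| ≤ 14 * M ^ 7 := by
  have hx' := Ioo_subset_Icc_self hx
  have ht' := Ioo_subset_Icc_self ht
  have := H.abs_boundary_deriv_le (X := fun σ => σ) (τ := fun _ => t) (s := x) hx ht
    continuousAt_id continuousAt_const (H.smooth.hasDerivAt_x x 0 t)
    (H.smooth.Dy.hasDerivAt_x x 0 t) (H.smooth_v.hasDerivAt_fst x t)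
    (H.bound_v x hx' t ht').2.1 (H.euler.2.1.pd1.hasDerivAt_fst x t)
    (H.P_bound x hx' t ht').2.2.2.1 (H.euler.1.hasDerivAt_fst x t) (H.abs_Ux_le hx' ht')
  rwa [H.smooth.Dx_Dy] at this

theorem boundary_Dt_le (hx : x ∈ Ioo 0 L) (ht : t ∈ Ioo 0 T) :
    |Dy (Dt u) x 0 t - bcoef U x 0 t * Dt u x 0 t / (u x 0 t + ε) ^ 2| ≤ 14 * M ^ 7 := by
  have hx' := Ioo_subset_Icc_self hx
  have ht' := Ioo_subset_Icc_self ht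
  have := H.abs_boundary_deriv_le (X := fun _ => x) (τ := fun σ => σ) (s := t) hx ht
    continuousAt_const continuousAt_id (H.smooth.hasDerivAt_t x 0 t)
    (H.smooth.Dy.hasDerivAt_t x 0 t) (H.smooth_v.hasDerivAt_snd x t)
    (H.bound_v x hx' t ht').2.2.1 (H.euler.2.1.pd1.hasDerivAt_snd x t)
    (H.P_bound x hx' t ht').2.2.2.2.2 (H.euler.1.hasDerivAt_snd x t) (H.abs_Ut_le hx' ht')
  rwa [H.smooth.Dt_Dy] at this

end BoundedSolution

/-- A bound for `∫ |∂_y u|`. -/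
def dyBound (L T M : ℝ) : ℝ :=
  40 * M ^ 5 * (L * T) + 16 * M ^ 5 * T + 26 * M ^ 5 * (L * T) + 4 * M * L

/-- The bound produced by the weighted energy estimate from a bound `s` on the source term. -/
def weightedBound (L T M s : ℝ) : ℝ :=
  exp ((5 * (4 * M ^ 4) + 1) * T) * (s + 14 * M ^ 7 * (T + 2 * (L * T) + L))

/-- A bound for the integral of the source term in the linearized equation. -/
def sourceBound (L T M : ℝ) : ℝ := 4 * M ^ 4 * M ^ 2 * (L * T + dyBound L T M)

namespace BoundedSolution

variable {L T M ε : ℝ} {U P u₀ u₁ v₀ : ℝ → ℝ → ℝ} {u z S : ℝ → ℝ → ℝ → ℝ} {x y t : ℝ}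
  (H : BoundedSolution L T M ε U P u₀ u₁ v₀ u)
include H

theorem abs_zero_order_coef_le (hx : x ∈ Icc 0 L) (hy : y ∈ Icc (0:ℝ) 1) (ht : t ∈ Icc 0 T) :
    |ccoef U P x y t * (1 - 2 * u x y t / (u x y t + ε))| ≤ 4 * M ^ 4 := by
  have hw := H.w_pos hx hy ht
  have hu := H.u_nonneg hx hy ht
  have h : |1 - 2 * u x y t / (u x y t + ε)| ≤ 1 := by
    have h1 : 0 ≤ 2 * u x y t / (u x y t + ε) := by positivity
    have h2 : 2 * u x y t / (u x y t + ε) ≤ 2 := by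
      rw [div_le_iff₀ hw]; linarith [H.hε.1]
    rw [abs_le]; constructor <;> linarith
  rw [abs_mul]
  nlinarith [H.abs_ccoef_le hx hy ht, abs_nonneg (ccoef U P x y t)]

theorem integral_weighted_abs_le (hz : Smooth3 z) {s : ℝ}
    (hcS : ContinuousOn (fun p : ℝ × ℝ × ℝ => S p.1 p.2.1 p.2.2) (closedCylinder L T))
    (hS : ∀ x ∈ Icc 0 L, ∀ y ∈ Icc (0:ℝ) 1, ∀ t ∈ Icc 0 T, 0 ≤ S x y t)
    (hs : ∫ p in QT L T, S p.1 p.2.1 p.2.2 ≤ s)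
    (heq : ∀ x ∈ Ioo 0 L, ∀ y ∈ Ioo (0:ℝ) 1, ∀ t ∈ Ioo 0 T,
      (1 - y + ε) * |Dt z x y t - (u x y t + ε) ^ 2 * Dy (Dy z) x y t
        + (y * U x t + ε) * Dx z x y t + bcoef U x y t * Dy z x y t
        + (ccoef U P x y t * (1 - 2 * u x y t / (u x y t + ε))
          - 2 * (Dt u x y t + (y * U x t + ε) * Dx u x y t
            + bcoef U x y t * Dy u x y t) / (u x y t + ε)) * z x y t|
      ≤ 4 * M ^ 4 * (1 - y + ε) * |z x y t| + (u x y t + ε) ^ 2 * S x y t)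
    (hinit : ∀ x ∈ Ioo 0 L, ∀ y ∈ Ioo (0:ℝ) 1,
      (1 - y + ε) * |z x y 0| / (u x y 0 + ε) ^ 2 ≤ 14 * M ^ 7)
    (hleft : ∀ y ∈ Ioo (0:ℝ) 1, ∀ t ∈ Ioo 0 T,
      (y * U 0 t + ε) * (1 - y + ε) * |z 0 y t| / (u 0 y t + ε) ^ 2 ≤ 14 * M ^ 7)
    (htop : ∀ x ∈ Ioo 0 L, ∀ t ∈ Ioo 0 T, z x 1 t = 0)
    (hbot : ∀ x ∈ Ioo 0 L, ∀ t ∈ Ioo 0 T,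
      |Dy z x 0 t - bcoef U x 0 t * z x 0 t / (u x 0 t + ε) ^ 2| ≤ 14 * M ^ 7) :
    ∫ p in QT L T, (1 - p.2.1 + ε) * |z p.1 p.2.1 p.2.2| / (u p.1 p.2.1 p.2.2 + ε) ^ 2
      ≤ weightedBound L T M s := by
  refine (_root_.integral_weighted_abs_le (w := fun x y t => u x y t + ε)
    (A := fun x y t => y * U x t + ε) (Ax := fun x y t => y * pd1 U x t)
    (b := bcoef U) (b' := fun x y t => -2 * y * pd1 U x t - pd2 U x t / U x t)
    (r := fun x y t => ccoef U P x y t * (1 - 2 * u x y t / (u x y t + ε)))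
    (k := 4 * M ^ 4) (B := 14 * M ^ 7) (S := S) H.hL H.hT H.hε (by positivity)
    (H.smooth.add_const ε) hz (fun x hx y hy t ht => H.w_pos hx hy ht)
    (fun x _ y _ t _ => H.hasDerivAt_A_x) (fun x _ y _ t _ => hasDerivAt_bcoef_y)
    H.continuousOn_A H.continuousOn_A_x H.continuousOn_bcoef H.continuousOn_bcoef_y hcS hS
    (fun x hx y hy t ht => H.A_nonneg hx hy ht) (fun x hx y hy t ht => H.abs_A_x_le hx hy ht)
    (fun x hx y hy t ht => H.abs_bcoef_y_le hx hy ht)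
    (fun x hx y hy t ht => H.abs_bcoef_le hx hy ht)
    (fun x hx y hy t ht => H.abs_zero_order_coef_le hx hy ht) ?_ hinit hleft htop
    (fun x hx t ht => H.bcoef_zero_nonneg (Ioo_subset_Icc_self hx) (Ioo_subset_Icc_self ht))
    hbot).trans ?_
  · intro x hx y hy t ht
    rw [Dt_add_const, Dx_add_const, Dy_add_const]
    exact heq x hx y hy t ht
  · unfold weightedBound
    gcongr

theorem continuousOn_weighted_abs (hz : Smooth3 z) :
    ContinuousOn (fun p : ℝ × ℝ × ℝ =>
      (1 - p.2.1 + ε) * |z p.1 p.2.1 p.2.2| / (u p.1 p.2.1 p.2.2 + ε) ^ 2)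
      (closedCylinder L T) := by
  have h1 := hz.continuous
  have h2 := H.smooth.continuous
  refine ContinuousOn.div (by fun_prop) (by fun_prop) fun p hp => ?_
  exact pow_ne_zero 2 (H.w_pos hp.1 hp.2.1 hp.2.2).ne'

theorem continuousOn_source :
    ContinuousOn (fun p : ℝ × ℝ × ℝ => 4 * M ^ 4 * M ^ 2 * (1 + |Dy u p.1 p.2.1 p.2.2|))
      (closedCylinder L T) := by
  have := H.smooth.Dy.continuous
  fun_prop

theorem integral_source_le :
    ∫ p in QT L T, 4 * M ^ 4 * M ^ 2 * (1 + |Dy u p.1 p.2.1 p.2.2|) ≤ sourceBound L T M := by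
  have hc : Continuous fun p : ℝ × ℝ × ℝ => |Dy u p.1 p.2.1 p.2.2| :=
    H.smooth.Dy.continuous.abs
  have hi : ∫ p in QT L T, 1 + |Dy u p.1 p.2.1 p.2.2|
      = 1 * (L * T) + ∫ p in QT L T, |Dy u p.1 p.2.1 p.2.2| := by
    rw [integral_add (integrableOn_QT continuousOn_const) (integrableOn_QT hc.continuousOn),
      integral_QT_const H.hL H.hT]
  rw [integral_const_mul, hi, sourceBound, dyBound, one_mul]
  gcongr
  exact H.integral_abs_Dy_le

theorem integral_weighted_abs_Dx_le :
    ∫ p in QT L T, (1 - p.2.1 + ε) * |Dx u p.1 p.2.1 p.2.2| / (u p.1 p.2.1 p.2.2 + ε) ^ 2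
      ≤ weightedBound L T M (sourceBound L T M) :=
  H.integral_weighted_abs_le (S := fun x y t => 4 * M ^ 4 * M ^ 2 * (1 + |Dy u x y t|))
    H.smooth.Dx H.continuousOn_source (fun _ _ _ _ _ _ => by positivity) H.integral_source_le
    (fun _ hx _ hy _ ht => H.linearized_x_le hx hy ht)
    (fun _ hx _ hy => H.weight_Dx_initial hx hy) (fun _ hy _ ht => H.weight_Dx_left hy ht)
    (fun _ hx _ ht => H.Dx_top hx (Ioo_subset_Icc_self ht))
    (fun _ hx _ ht => H.boundary_Dx_le hx ht)

theorem integral_weighted_abs_Dt_le :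
    ∫ p in QT L T, (1 - p.2.1 + ε) * |Dt u p.1 p.2.1 p.2.2| / (u p.1 p.2.1 p.2.2 + ε) ^ 2
      ≤ weightedBound L T M (sourceBound L T M
        + 4 * M ^ 4 * weightedBound L T M (sourceBound L T M)) := by
  have hM := H.M_pos
  have hcq : ContinuousOn (fun p : ℝ × ℝ × ℝ => 4 * M ^ 4 * ((1 - p.2.1 + ε)
      * |Dx u p.1 p.2.1 p.2.2| / (u p.1 p.2.1 p.2.2 + ε) ^ 2)) (closedCylinder L T) :=
    continuousOn_const.mul (H.continuousOn_weighted_abs H.smooth.Dx)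
  refine H.integral_weighted_abs_le (S := fun x y t => 4 * M ^ 4 * M ^ 2 * (1 + |Dy u x y t|)
      + 4 * M ^ 4 * ((1 - y + ε) * |Dx u x y t| / (u x y t + ε) ^ 2))
    H.smooth.Dt (H.continuousOn_source.add hcq) ?_ ?_ ?_
    (fun _ hx _ hy => H.weight_Dt_initial hx hy) (fun _ hy _ ht => H.weight_Dt_left hy ht)
    (fun _ hx _ ht => H.Dt_top (Ioo_subset_Icc_self hx) ht)
    (fun _ hx _ ht => H.boundary_Dt_le hx ht)
  · intro x hx y hy t ht
    have := H.phi_pos hy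
    positivity
  · rw [integral_add (integrableOn_QT H.continuousOn_source)
      (integrableOn_QT hcq), integral_const_mul (4 * M ^ 4)]
    have := H.integral_source_le
    have := H.integral_weighted_abs_Dx_le
    gcongr
  · intro x hx y hy t ht
    refine (H.linearized_t_le hx hy ht).trans ?_
    have hw := H.w_pos (Ioo_subset_Icc_self hx) (Ioo_subset_Icc_self hy) (Ioo_subset_Icc_self ht)
    have hφ := H.phi_pos (Ioo_subset_Icc_self hy)
    have h0 : 0 ≤ 4 * M ^ 4 * (1 - y + ε) * |Dt u x y t| := by positivity
    have e : (u x y t + ε) ^ 2 * (4 * M ^ 4 * ((1 - y + ε) * |Dx u x y t| / (u x y t + ε) ^ 2))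
        = 4 * M ^ 4 * (1 - y + ε) * |Dx u x y t| := by field_simp
    rw [mul_add ((u x y t + ε) ^ 2), e]
    linarith

theorem integral_abs_le_of_weighted (hz : Smooth3 z) {N : ℝ}
    (h : ∫ p in QT L T, (1 - p.2.1 + ε) * |z p.1 p.2.1 p.2.2| / (u p.1 p.2.1 p.2.2 + ε) ^ 2
      ≤ N) :
    ∫ p in QT L T, |z p.1 p.2.1 p.2.2| ≤ 2 * M ^ 2 * N := by
  have hM := H.M_pos
  have hc : Continuous fun p : ℝ × ℝ × ℝ => |z p.1 p.2.1 p.2.2| := hz.continuous.abs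
  have hcq : ContinuousOn (fun p : ℝ × ℝ × ℝ => 2 * M ^ 2 * ((1 - p.2.1 + ε)
      * |z p.1 p.2.1 p.2.2| / (u p.1 p.2.1 p.2.2 + ε) ^ 2)) (closedCylinder L T) :=
    continuousOn_const.mul (H.continuousOn_weighted_abs hz)
  refine (setIntegral_mono_on (integrableOn_QT hc.continuousOn)
    (integrableOn_QT hcq) (measurableSet_QT L T) (fun p hp => ?_)).trans
    ((integral_const_mul (2 * M ^ 2) _).le.trans (by gcongr))
  have hp' := QT_subset_closedCylinder L T hp
  have hw := H.w_pos hp'.1 hp'.2.1 hp'.2.2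
  have hφ := H.phi_pos hp'.2.1
  have h1 := (H.w_bounds hp'.1 hp'.2.1 hp'.2.2).2
  have h2 := H.phi_le hp'.2.1
  rw [mul_div_assoc', le_div_iff₀ (by positivity)]
  generalize u p.1 p.2.1 p.2.2 + ε = w at *
  generalize 1 - p.2.1 + ε = φ at *
  have h3 : w ^ 2 ≤ 2 * M ^ 2 * φ := by
    calc w ^ 2 ≤ (M * φ) ^ 2 := by gcongr
      _ = M ^ 2 * φ * φ := by ring
      _ ≤ M ^ 2 * φ * 2 := by gcongr
      _ = _ := by ring
  nlinarith [abs_nonneg (z p.1 p.2.1 p.2.2)]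

theorem integral_abs_gradient_le :
    ∫ p in QT L T, (|Dx u p.1 p.2.1 p.2.2| + |Dy u p.1 p.2.1 p.2.2| + |Dt u p.1 p.2.1 p.2.2|)
      ≤ 2 * M ^ 2 * weightedBound L T M (sourceBound L T M) + dyBound L T M
        + 2 * M ^ 2 * weightedBound L T M (sourceBound L T M
          + 4 * M ^ 4 * weightedBound L T M (sourceBound L T M)) := by
  have h1 : Continuous fun p : ℝ × ℝ × ℝ => |Dx u p.1 p.2.1 p.2.2| := H.smooth.Dx.continuous.abs
  have h2 : Continuous fun p : ℝ × ℝ × ℝ => |Dy u p.1 p.2.1 p.2.2| := H.smooth.Dy.continuous.abs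
  have h3 : Continuous fun p : ℝ × ℝ × ℝ => |Dt u p.1 p.2.1 p.2.2| := H.smooth.Dt.continuous.abs
  have h12 : Continuous fun p : ℝ × ℝ × ℝ => |Dx u p.1 p.2.1 p.2.2| + |Dy u p.1 p.2.1 p.2.2| :=
    h1.add h2
  rw [integral_add (integrableOn_QT h12.continuousOn) (integrableOn_QT h3.continuousOn),
    integral_add (integrableOn_QT h1.continuousOn) (integrableOn_QT h2.continuousOn)]
  have hy : ∫ p in QT L T, |Dy u p.1 p.2.1 p.2.2| ≤ dyBound L T M := H.integral_abs_Dy_le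
  have hx := H.integral_abs_le_of_weighted H.smooth.Dx H.integral_weighted_abs_Dx_le
  have ht := H.integral_abs_le_of_weighted H.smooth.Dt H.integral_weighted_abs_Dt_le
  gcongr

end BoundedSolution

/-- Proposition 2.3: uniform total-variation (full gradient `L¹`) estimate for the
regularized solutions. -/
theorem total_variation_bound (L T C₀ M : ℝ)
    (hL : 0 < L) (hT : 0 < T) (hC₀ : 0 < C₀) (hM : 0 < M) :
    ∃ C₂ > (0:ℝ), ∀ ε ∈ Ioo (0:ℝ) 1, ∀ U P : ℝ → ℝ → ℝ, ∀ u₀ u₁ v₀ : ℝ → ℝ → ℝ,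
      ∀ u : ℝ → ℝ → ℝ → ℝ, ∀ C₁ : ℝ,
      EulerData L T M U P →
      DataBounds L T C₀ u₀ u₁ v₀ →
      C2Bound u₀ (Icc 0 L) (Icc 0 1) M →
      C2Bound u₁ (Icc 0 1) (Icc 0 T) M →
      C2Bound v₀ (Icc 0 L) (Icc 0 T) M →
      RegSolution L T ε U P u₀ u₁ v₀ u →
      0 < C₁ → C₁ ≤ M →
      (∀ x ∈ Ioo 0 L, ∀ y ∈ Ioo (0:ℝ) 1, ∀ t ∈ Ioo 0 T,
        C₁⁻¹ * (1 - y) ≤ u x y t ∧ u x y t ≤ C₁ * (1 - y)) →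
      ∫⁻ p in QT L T,
          ENNReal.ofReal (|Dx u p.1 p.2.1 p.2.2| + |Dy u p.1 p.2.1 p.2.2|
            + |Dt u p.1 p.2.1 p.2.2|)
        ≤ ENNReal.ofReal C₂ := by
  have hd : 0 < dyBound L T M := by unfold dyBound; positivity
  have hs : 0 < sourceBound L T M := by unfold sourceBound; positivity
  have hw : ∀ s, 0 < s → 0 < weightedBound L T M s := fun s h => by
    unfold weightedBound; positivity
  have hw1 := hw _ hs
  have hw2 := hw (sourceBound L T M + 4 * M ^ 4 * weightedBound L T M (sourceBound L T M))
    (by positivity)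
  refine ⟨2 * M ^ 2 * weightedBound L T M (sourceBound L T M) + dyBound L T M
    + 2 * M ^ 2 * weightedBound L T M (sourceBound L T M
      + 4 * M ^ 4 * weightedBound L T M (sourceBound L T M)), by positivity, ?_⟩
  intro ε hε U P u₀ u₁ v₀ u C₁ hE hD hb₀ hb₁ hbv hu hC₁ hC₁M hbd
  have hM1 : 1 ≤ M := by
    have h0 : (0:ℝ) ∈ Icc 0 L := ⟨le_rfl, hL.le⟩
    have h0' : (0:ℝ) ∈ Icc 0 T := ⟨le_rfl, hT.le⟩
    have h1 := hE.2.2.2.2.2.2.2 0 h0 0 h0'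
    have h2 := (le_abs_self _).trans (hE.2.2.2.2.2.1 0 h0 0 h0').1
    have h3 := (inv_le_iff_one_le_mul₀ hM).1 (h1.trans h2)
    nlinarith
  have H : BoundedSolution L T M ε U P u₀ u₁ v₀ u :=
    { hL := hL
      hT := hT
      one_le := hM1
      hε := hε
      euler := hE
      smooth₀ := hD.1
      smooth₁ := hD.2.1
      smooth_v := hD.2.2.1
      bound₀ := hb₀
      bound₁ := hb₁
      bound_v := hbv
      sol := hu
      bounds := fun x hx y hy t ht => by
        have hy1 : 0 ≤ 1 - y := by linarith [hy.2]
        obtain ⟨h1, h2⟩ := hbd x hx y hy t ht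
        have h3 : M⁻¹ ≤ C₁⁻¹ := by gcongr
        exact ⟨(mul_le_mul_of_nonneg_right h3 hy1).trans h1,
          h2.trans (mul_le_mul_of_nonneg_right hC₁M hy1)⟩ }
  have hc : Continuous fun p : ℝ × ℝ × ℝ =>
      |Dx u p.1 p.2.1 p.2.2| + |Dy u p.1 p.2.1 p.2.2| + |Dt u p.1 p.2.1 p.2.2| :=
    (H.smooth.Dx.continuous.abs.add H.smooth.Dy.continuous.abs).add H.smooth.Dt.continuous.abs
  rw [← ofReal_integral_eq_lintegral_ofReal (integrableOn_QT hc.continuousOn)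
    (Filter.Eventually.of_forall fun p => by positivity)]
  exact ENNReal.ofReal_le_ofReal H.integral_abs_gradient_le

end
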